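/- arXiv:1402.1506 — 4 statements merged into one kernel-verified Lean document; each statement's English description precedes it below -/
import Mathlib

section
/- Let 𝒫 be a number system partition for (M,φ) whose language ℒ fulfills the specification property, and let k ∈ ℕ. Then for every q ∈ S_k and every n ≥ 1 the set Z_n(q,k) = {ω ∈ ℒ : |ω| ≥ kn·|ℒ_k| and ‖P_k(ω) − q‖_1 ≤ 1/n} is nonempty. -/
open Filter Topology Set

namespace Paper

/-- The ℓ¹ distance between two finitely-indexed real vectors. -/
noncomputable def dist1 {α : Type*} [Fintype α] (p q : α → ℝ) : ℝ :=
  ∑ b, |p b - q b|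

/-- The simplex of probability vectors indexed by `α`. -/
def Simplex (α : Type*) [Fintype α] : Set (α → ℝ) :=
  {p | (∀ b, 0 ≤ p b) ∧ ∑ b, p b = 1}

/-- The set of accumulation points, in the simplex with the ℓ¹ norm, of a sequence
of vectors. -/
def AccPts {α : Type*} [Fintype α] (f : ℕ → (α → ℝ)) : Set (α → ℝ) :=
  {p | p ∈ Simplex α ∧ ∀ ε : ℝ, 0 < ε → ∀ n₀ : ℕ, ∃ n, n₀ ≤ n ∧ dist1 (f n) p < ε}

/-- `freq ω b n` is the frequency of the block `b` among the first `n` letters of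
the infinite word `ω`. -/
noncomputable def freq {N : ℕ} (ω : ℕ → Fin N) (b : List (Fin N)) (n : ℕ) : ℝ :=
  (((Finset.range n).filter fun i =>
      (List.ofFn fun m : Fin b.length => ω (i + (m : ℕ))) = b).card : ℝ) / n

/-- The vector of frequencies of all blocks of length `k` among the first `n`
letters of the infinite word `ω`. -/
noncomputable def freqVec {N : ℕ} (k : ℕ) (ω : ℕ → Fin N) (n : ℕ) :
    (Fin k → Fin N) → ℝ :=
  fun b => freq ω (List.ofFn b) n

/-- `wordFreqAt w b n` is the frequency of the block `b` among the first `n`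
positions of the finite word `w`. -/
noncomputable def wordFreqAt {N : ℕ} (w b : List (Fin N)) (n : ℕ) : ℝ :=
  (((Finset.range n).filter fun i => (w.drop i).take b.length = b).card : ℝ) / n

/-- The frequency of the block `b` among all positions of the finite word `w`. -/
noncomputable def wordFreq {N : ℕ} (w b : List (Fin N)) : ℝ :=
  wordFreqAt w b w.length

/-- The vector of frequencies of all blocks of length `k` in the finite word `w`. -/
noncomputable def wordFreqVec {N : ℕ} (k : ℕ) (w : List (Fin N)) :
    (Fin k → Fin N) → ℝ :=
  fun b => wordFreq w (List.ofFn b)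

/-- The vector of frequencies of all blocks of length `k` among the first `n`
positions of the finite word `w`. -/
noncomputable def wordFreqVecAt {N : ℕ} (k : ℕ) (w : List (Fin N)) (n : ℕ) :
    (Fin k → Fin N) → ℝ :=
  fun b => wordFreqAt w (List.ofFn b) n

/-- The iterated Cesàro averages of the block frequencies:
`cfreq 0 ω b n = freq ω b n` and `cfreq (r+1) ω b n = (∑_{j=1}^n cfreq r ω b j)/n`. -/
noncomputable def cfreq {N : ℕ} : ℕ → (ℕ → Fin N) → List (Fin N) → ℕ → ℝ
  | 0, ω, b, n => freq ω b n
  | r + 1, ω, b, n => (∑ j ∈ Finset.Icc 1 n, cfreq r ω b j) / n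

/-- The vector of `r`-th iterated Cesàro averages of the frequencies of blocks of
length `k`. -/
noncomputable def cfreqVec {N : ℕ} (r k : ℕ) (ω : ℕ → Fin N) (n : ℕ) :
    (Fin k → Fin N) → ℝ :=
  fun b => cfreq r ω (List.ofFn b) n

/-- The tower functions: `tow 1 x = 2^x`, `tow m x = 2^(tow (m-1) x)`. -/
def tow (m x : ℕ) : ℕ := (fun y => 2 ^ y)^[m] x

section Dyn

variable {N : ℕ} {M : Type*} [MetricSpace M] [CompactSpace M]

/-- A word `w` is allowed for `(𝒫, φ)` if `⋂_{k=1}^{|w|} φ^{-k}(P_{w_k}) ≠ ∅`. -/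
def Allowed (φ : M → M) (P : Fin N → Set M) (w : List (Fin N)) : Prop :=
  (⋂ m : Fin w.length, (φ^[(m : ℕ) + 1]) ⁻¹' P (w.get m)).Nonempty

/-- The language of `(𝒫, φ)`: the set of allowed words. -/
def Lang (φ : M → M) (P : Fin N → Set M) : Set (List (Fin N)) :=
  {w | Allowed φ P w}

/-- The words of length `k` in the language of `(𝒫, φ)`. -/
def LangK (φ : M → M) (P : Fin N → Set M) (k : ℕ) : Set (List (Fin N)) :=
  {w | Allowed φ P w ∧ w.length = k}

/-- The one-sided shift space corresponding to `(𝒫, φ)`: the infinite words all of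
whose finite prefixes are allowed. -/
def ShiftSpace (φ : M → M) (P : Fin N → Set M) : Set (ℕ → Fin N) :=
  {ω | ∀ n : ℕ, (List.ofFn fun m : Fin n => ω (m : ℕ)) ∈ Lang φ P}

/-- The language fulfills the specification property with parameter `j`. -/
def Spec (φ : M → M) (P : Fin N → Set M) (j : ℕ) : Prop :=
  ∀ a ∈ Lang φ P, ∀ b ∈ Lang φ P,
    ∃ u ∈ Lang φ P, u.length ≤ j ∧ a ++ u ++ b ∈ Lang φ P

/-- The cylinder set `D_n(ω) = ⋂_{m=0}^n φ^{-m}(P_{ω_m})` in `M`. -/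
def Dn (φ : M → M) (P : Fin N → Set M) (ω : ℕ → Fin N) (n : ℕ) : Set M :=
  ⋂ m : Fin (n + 1), (φ^[(m : ℕ)]) ⁻¹' P (ω (m : ℕ))

/-- `𝒫` is a number system partition for `(M, φ)`: a topological partition
(pairwise disjoint open sets whose closures cover `M`) for a continuous `φ`, such
that `⋂_n cl(D_n(ω))` is a singleton for every `ω` in the shift space. -/
def IsNSP (φ : M → M) (P : Fin N → Set M) : Prop :=
  Continuous φ ∧ (∀ i, IsOpen (P i)) ∧ (Pairwise fun i j => Disjoint (P i) (P j)) ∧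
    (⋃ i, closure (P i)) = Set.univ ∧
    ∀ ω ∈ ShiftSpace φ P, ∃ x : M, (⋂ n : ℕ, closure (Dn φ P ω n)) = {x}

/-- The set `U_∞ = ⋂_{k≥0} φ^{-k}(U)` where `U = ⋃ᵢ Pᵢ`. -/
def Uinf (φ : M → M) (P : Fin N → Set M) : Set M :=
  ⋂ n : ℕ, (φ^[n]) ⁻¹' (⋃ i, P i)

/-- `S_k`, the union over all `ω` in the shift space of the sets of accumulation
points of the sequences of frequency vectors of blocks of length `k`. -/
def SK (φ : M → M) (P : Fin N → Set M) (k : ℕ) : Set ((Fin k → Fin N) → ℝ) :=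
  ⋃ ω ∈ ShiftSpace φ P, AccPts (freqVec k ω)

/-- `𝔻 = ℚ^{ℒ_k} ∩ S_k`: the elements of `S_k` with rational coordinates. -/
def DD (φ : M → M) (P : Fin N → Set M) (k : ℕ) : Set ((Fin k → Fin N) → ℝ) :=
  {p | p ∈ SK φ P k ∧ ∀ b, ∃ q : ℚ, p b = (q : ℝ)}

/-- Property `P` of a sequence of vectors. -/
def HasPropP (φ : M → M) (P : Fin N → Set M) {k : ℕ}
    (f : ℕ → ((Fin k → Fin N) → ℝ)) : Prop :=
  ∀ p ∈ DD φ P k, ∀ m : ℕ, 1 ≤ m → ∀ i : ℕ, ∀ ε : ℝ, 0 < ε →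
    ∃ j : ℕ, i ≤ j ∧ (j : ℝ) / 2 ^ j < ε ∧
      ∀ n : ℕ, j < n → n < tow m (2 ^ j) → dist1 (f n) p < ε

/-- Property `P_{h,m,q,i}` of a sequence of vectors. -/
def HasPropPh {α : Type*} [Fintype α] (h m i : ℕ) (q : α → ℝ)
    (f : ℕ → (α → ℝ)) : Prop :=
  ∀ ε : ℝ, 1 / (h : ℝ) < ε →
    ∃ j : ℕ, i ≤ j ∧ (j : ℝ) / 2 ^ j < ε ∧
      ∀ n : ℕ, j < n → n < tow m (2 ^ j) → dist1 (f n) q < ε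

end Dyn

/-- Two predicates agreeing on all `i` with `i + k ≤ m` have counts differing by at most `k`. -/
theorem card_filter_aux (m k : ℕ) (p r : ℕ → Prop) [DecidablePred p] [DecidablePred r]
    (h : ∀ i, i + k ≤ m → p i → r i) :
    ((Finset.range m).filter p).card ≤ ((Finset.range m).filter r).card + k := by
  have hs : (Finset.range m).filter p ⊆ (Finset.range m).filter r ∪ Finset.Ico (m - k) m := by
    intro i hi
    simp only [Finset.mem_filter, Finset.mem_range, Finset.mem_union, Finset.mem_Ico] at hi ⊢
    by_cases hik : i + k ≤ m
    · exact Or.inl ⟨hi.1, h i hik hi.2⟩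
    · right
      omega
  refine (Finset.card_le_card hs).trans ((Finset.card_union_le _ _).trans ?_)
  simp only [Nat.card_Ico]
  omega

theorem take_drop_ofFn {N : ℕ} (ω : ℕ → Fin N) (m l i : ℕ) (h : i + l ≤ m) :
    ((List.ofFn fun t : Fin m => ω (t : ℕ)).drop i).take l =
      List.ofFn fun t : Fin l => ω (i + (t : ℕ)) := by
  apply List.ext_getElem
  · simp only [List.length_take, List.length_drop, List.length_ofFn]
    omega
  · intro a h1 h2
    simp

theorem wordFreq_sub_freq {N : ℕ} (ω : ℕ → Fin N) (b : List (Fin N)) (m : ℕ) :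
    |wordFreq (List.ofFn fun t : Fin m => ω (t : ℕ)) b - freq ω b m| ≤ (b.length : ℝ) / m := by
  unfold wordFreq wordFreqAt freq
  rw [List.length_ofFn, ← sub_div, abs_div, Nat.abs_cast]
  apply div_le_div_of_nonneg_right _ (Nat.cast_nonneg m)
  have h1 := card_filter_aux m b.length
    (fun i => ((List.ofFn fun t : Fin m => ω (t : ℕ)).drop i).take b.length = b)
    (fun i => (List.ofFn fun t : Fin b.length => ω (i + (t : ℕ))) = b)
    (fun i hi hp => by rwa [take_drop_ofFn ω m _ i hi] at hp)
  have h2 := card_filter_aux m b.length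
    (fun i => (List.ofFn fun t : Fin b.length => ω (i + (t : ℕ))) = b)
    (fun i => ((List.ofFn fun t : Fin m => ω (t : ℕ)).drop i).take b.length = b)
    (fun i hi hp => by rwa [take_drop_ofFn ω m _ i hi])
  rw [abs_le]
  constructor
  · have := (Nat.cast_le (α := ℝ)).2 h2
    push_cast at this
    linarith
  · have := (Nat.cast_le (α := ℝ)).2 h1
    push_cast at this
    linarith

/-- for every `q ∈ S_k` and every `n ≥ 1` the set
`Z_n(q,k) = {ω ∈ ℒ : |ω| ≥ kn·|ℒ_k| and ‖P_k(ω) − q‖₁ ≤ 1/n}` is nonempty. -/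
theorem Zn_nonempty
    {N : ℕ}
    {M : Type*} [MetricSpace M] [CompactSpace M]
    (φ : M → M) (P : Fin N → Set M)
    (hNSP : IsNSP φ P)
    (j : ℕ) (hspec : Spec φ P j)
    (k : ℕ) (hk : 1 ≤ k)
    (q : (Fin k → Fin N) → ℝ) (hq : q ∈ SK φ P k)
    (n : ℕ) (hn : 1 ≤ n) :
    ∃ w ∈ Lang φ P, k * n * (LangK φ P k).ncard ≤ w.length ∧
      dist1 (wordFreqVec k w) q ≤ 1 / (n : ℝ) := by
  have hn' : (0 : ℝ) < n := by exact_mod_cast hn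
  simp only [SK, Set.mem_iUnion] at hq
  obtain ⟨ω, hω, -, hacc⟩ := hq
  set C : ℕ := Fintype.card (Fin k → Fin N) with hC
  obtain ⟨m, hm, hd⟩ := hacc (1 / (2 * n)) (by positivity)
    (k * n * (LangK φ P k).ncard + 2 * n * (C * k) + 1)
  have hm0 : (0 : ℝ) < m := by
    have : 0 < m := by omega
    exact_mod_cast this
  refine ⟨List.ofFn fun t : Fin m => ω (t : ℕ), hω m, ?_, ?_⟩
  · rw [List.length_ofFn]
    omega
  have hmC : (2 * n * (C * k) : ℝ) ≤ m := by
    have : 2 * n * (C * k) ≤ m := by omega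
    exact_mod_cast this
  have key : dist1 (wordFreqVec k (List.ofFn fun t : Fin m => ω (t : ℕ))) q ≤
      C * ((k : ℝ) / m) + dist1 (freqVec k ω m) q := by
    have e : (C * ((k : ℝ) / m)) = ∑ _b : Fin k → Fin N, (k : ℝ) / m := by
      rw [Finset.sum_const, Finset.card_univ, nsmul_eq_mul]
    unfold dist1
    rw [e, ← Finset.sum_add_distrib]
    refine Finset.sum_le_sum fun b _ => ?_
    have h := wordFreq_sub_freq ω (List.ofFn b) m
    rw [List.length_ofFn] at h
    exact (abs_sub_le _ (freqVec k ω m b) _).trans (add_le_add_left h _)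
  have h3 : C * ((k : ℝ) / m) ≤ 1 / (2 * n) := by
    rw [← mul_div_assoc, div_le_div_iff₀ hm0 (by positivity)]
    linarith
  have h4 : (1 : ℝ) / (2 * n) + 1 / (2 * n) = 1 / n := by
    field_simp
    norm_num
  linarith

end Paper
end

section
/- Let 𝒫 be a number system partition for (M,φ) whose language ℒ fulfills the specification property with parameter j. Let k ∈ ℕ and let q_1, q_2, …, q_m ∈ S_k. Then for every ε > 0 and every ω_0 ∈ ℒ there exist a finite word ω ∈ ℒ having ω_0 as a prefix and integers n_1 < n_2 < … < n_m such that ‖P_k(ω, n_i) − q_i‖_1 ≤ ε for all 1 ≤ i ≤ m. -/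
open Filter Topology Set

namespace Paper

lemma take_drop_block {N : ℕ} (k n i : ℕ) (hi : i < n) (x : ℕ → Fin N) (v t : List (Fin N)) :
    (((v ++ (List.ofFn fun m : Fin (n + k) => x (m : ℕ))) ++ t).drop (v.length + i)).take k
      = List.ofFn fun m : Fin k => x (i + (m : ℕ)) := by
  rw [List.append_assoc, ← List.drop_drop, List.drop_left]
  apply List.ext_getElem
  · simp; omega
  · intro a h1 h2
    simp at h2
    rw [List.getElem_take, List.getElem_drop, List.getElem_append_left (by simp; omega)]
    simp

lemma count_split (l n : ℕ) (p r : ℕ → Prop) [DecidablePred p] [DecidablePred r]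
    (h : ∀ i < n, (p (l + i) ↔ r i)) :
    ((Finset.range (l + n)).filter p).card
      = ((Finset.range l).filter p).card + ((Finset.range n).filter r).card := by
  simp only [Finset.card_filter, Finset.sum_range_add]
  congr 1
  apply Finset.sum_congr rfl
  intro i hi
  have := h i (Finset.mem_range.1 hi)
  simp [this]

lemma frac_bound (l n c a : ℝ) (hn : 0 < n) (hc : 0 ≤ c) (hcl : c ≤ l) (ha : 0 ≤ a)
    (han : a ≤ n) : |(c + a) / (l + n) - a / n| ≤ l / n := by
  have hl : 0 ≤ l := hc.trans hcl
  have hln : 0 < l + n := by linarith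
  have e : (c + a) / (l + n) - a / n = (c * n - a * l) / ((l + n) * n) := by
    field_simp; ring
  rw [e, abs_div, abs_of_pos (by positivity : 0 < (l + n) * n),
    div_le_div_iff₀ (by positivity) hn]
  have h1 : |c * n - a * l| ≤ l * n := by
    rw [abs_le]; constructor <;> nlinarith [mul_nonneg hc hn.le, mul_nonneg ha hl]
  nlinarith [mul_le_mul_of_nonneg_right h1 hn.le, mul_nonneg (mul_nonneg hl hl) hn.le]

lemma word_bound {N : ℕ} (k n : ℕ) (hn : 0 < n) (x : ℕ → Fin N) (v t : List (Fin N))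
    (b : Fin k → Fin N) :
    |wordFreqVecAt k ((v ++ (List.ofFn fun m : Fin (n + k) => x (m : ℕ))) ++ t) (v.length + n) b
      - freqVec k x n b| ≤ (v.length : ℝ) / n := by
  unfold wordFreqVecAt freqVec wordFreqAt freq
  rw [count_split v.length n _
    (fun i => (List.ofFn fun m : Fin (List.ofFn b).length => x (i + (m : ℕ))) = List.ofFn b)]
  · push_cast
    apply frac_bound
    · exact_mod_cast hn
    · positivity
    · exact_mod_cast (Finset.card_filter_le _ _).trans (by simp)
    · positivity
    · exact_mod_cast (Finset.card_filter_le _ _).trans (by simp)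
  · intro i hi
    have e : ∀ kk, kk = k →
        (((v ++ (List.ofFn fun m : Fin (n + k) => x (m : ℕ))) ++ t).drop (v.length + i)).take kk
          = List.ofFn fun m : Fin kk => x (i + (m : ℕ)) := by
      rintro _ rfl
      exact take_drop_block _ n i hi x v t
    rw [e _ List.length_ofFn]

lemma step_lemma {N : ℕ} {M : Type*} [MetricSpace M] [CompactSpace M]
    (φ : M → M) (P : Fin N → Set M) (j : ℕ) (hspec : Spec φ P j) (k : ℕ)
    (q : (Fin k → Fin N) → ℝ) (hq : q ∈ SK φ P k) (ε : ℝ) (hε : 0 < ε)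
    (ω₀ : List (Fin N)) (hω₀ : ω₀ ∈ Lang φ P) :
    ∃ ω ∈ Lang φ P, ω₀ <+: ω ∧ ∃ n, ω₀.length < n ∧ n ≤ ω.length ∧
      ∀ t, dist1 (wordFreqVecAt k (ω ++ t) n) q ≤ ε := by
  simp only [SK, mem_iUnion] at hq
  obtain ⟨x, hx, -, hacc⟩ := hq
  set K : ℝ := (Fintype.card (Fin k → Fin N) : ℝ) with hK
  have hK0 : 0 ≤ K := by positivity
  set L : ℝ := (ω₀.length : ℝ) + j with hL
  obtain ⟨n₀, hn₀⟩ := exists_nat_gt (K * L / (ε / 2))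
  obtain ⟨n, hn, hd⟩ := hacc (ε / 2) (by positivity) (n₀ + 1)
  obtain ⟨u, -, huj, hu⟩ := hspec ω₀ hω₀ _ (hx (n + k))
  have hn0 : 0 < n := by omega
  have hnR : (0 : ℝ) < n := by exact_mod_cast hn0
  refine ⟨_, hu, ?_, (ω₀ ++ u).length + n, ?_, ?_, ?_⟩
  · rw [List.append_assoc]; exact List.prefix_append _ _
  · simp; omega
  · simp; omega
  · intro t
    have h1 : ((ω₀ ++ u).length : ℝ) ≤ L := by
      rw [hL]; simp; exact_mod_cast huj
    have h2 : K * L / n ≤ ε / 2 := by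
      rw [div_le_iff₀ hnR]
      have h3 : (n₀ : ℝ) ≤ n := by exact_mod_cast (by omega : n₀ ≤ n)
      have := (div_lt_iff₀ (by positivity : 0 < ε / 2)).1 (hn₀.trans_le h3)
      linarith
    have h4 : ∀ b, |wordFreqVecAt k ((ω₀ ++ u ++ (List.ofFn fun m : Fin (n + k) => x (m : ℕ))) ++ t)
        ((ω₀ ++ u).length + n) b - q b| ≤ L / n + |freqVec k x n b - q b| := by
      intro b
      refine (abs_sub_le _ (freqVec k x n b) _).trans ?_
      have := word_bound k n hn0 x (ω₀ ++ u) t b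
      have h5 : ((ω₀ ++ u).length : ℝ) / n ≤ L / n := by gcongr
      linarith
    have h6 := Finset.sum_le_sum fun b (_ : b ∈ Finset.univ) => h4 b
    rw [Finset.sum_add_distrib, Finset.sum_const, nsmul_eq_mul, Finset.card_univ, ← hK,
      ← mul_div_assoc] at h6
    unfold dist1 at hd ⊢
    linarith

lemma multi_lemma {N : ℕ} {M : Type*} [MetricSpace M] [CompactSpace M]
    (φ : M → M) (P : Fin N → Set M) (j : ℕ) (hspec : Spec φ P j) (k : ℕ) (ε : ℝ) (hε : 0 < ε)
    (m : ℕ) : ∀ (q : Fin m → ((Fin k → Fin N) → ℝ)) (_ : ∀ i, q i ∈ SK φ P k)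
    (ω₀ : List (Fin N)) (_ : ω₀ ∈ Lang φ P),
    ∃ ω ∈ Lang φ P, ω₀ <+: ω ∧
      ∃ nseq : Fin m → ℕ, StrictMono nseq ∧ (∀ i, ω₀.length < nseq i) ∧
        (∀ i, nseq i ≤ ω.length) ∧
        ∀ i, ∀ t, dist1 (wordFreqVecAt k (ω ++ t) (nseq i)) (q i) ≤ ε := by
  induction m with
  | zero =>
    intro q _ ω₀ h
    exact ⟨ω₀, h, List.prefix_rfl, Fin.elim0, fun i => i.elim0, fun i => i.elim0,
      fun i => i.elim0, fun i => i.elim0⟩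
  | succ m ih =>
    intro q hq ω₀ h
    obtain ⟨ω₁, h1, p1, n, hn1, hn2, hn3⟩ := step_lemma φ P j hspec k (q 0) (hq 0) ε hε ω₀ h
    obtain ⟨ω₂, h2, p2, s, hs, hs1, hs2, hs3⟩ :=
      ih (fun i => q i.succ) (fun i => hq _) ω₁ h1
    refine ⟨ω₂, h2, p1.trans p2, Fin.cons n s, ?_, ?_, ?_, ?_⟩
    · intro a b hab
      induction a using Fin.cases with
      | zero =>
        induction b using Fin.cases with
        | zero => exact absurd hab (lt_irrefl _)
        | succ b => simpa using hn2.trans_lt (hs1 b)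
      | succ a =>
        induction b using Fin.cases with
        | zero => exact absurd hab (Fin.not_lt_zero _)
        | succ b => simpa using hs (Fin.succ_lt_succ_iff.1 hab)
    · intro i
      induction i using Fin.cases with
      | zero => simpa using hn1
      | succ i => simpa using p1.length_le.trans_lt (hs1 i)
    · intro i
      induction i using Fin.cases with
      | zero => simpa using hn2.trans p2.length_le
      | succ i => simpa using hs2 i
    · intro i t
      induction i using Fin.cases with
      | zero =>
        obtain ⟨r, rfl⟩ := p2
        simpa [List.append_assoc] using hn3 (r ++ t)
      | succ i => simpa using hs3 i t

/-- given `q_1, …, q_m ∈ S_k`, `ε > 0` and `ω_0 ∈ ℒ`, there is a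
word `ω ∈ ℒ` with prefix `ω_0` and times `n_1 < ⋯ < n_m` such that
`‖P_k(ω, n_i) − q_i‖₁ ≤ ε` for all `i`. -/
theorem distributions_lemma
    {N : ℕ}
    {M : Type*} [MetricSpace M] [CompactSpace M]
    (φ : M → M) (P : Fin N → Set M)
    (hNSP : IsNSP φ P)
    (j : ℕ) (hspec : Spec φ P j)
    (k : ℕ) (hk : 1 ≤ k)
    (m : ℕ) (hm : 1 ≤ m)
    (q : Fin m → ((Fin k → Fin N) → ℝ)) (hq : ∀ i, q i ∈ SK φ P k)
    (ε : ℝ) (hε : 0 < ε)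
    (ω₀ : List (Fin N)) (hω₀ : ω₀ ∈ Lang φ P) :
    ∃ ω ∈ Lang φ P, ω₀ <+: ω ∧
      ∃ nseq : Fin m → ℕ, StrictMono nseq ∧ (∀ i, nseq i ≤ ω.length) ∧
        ∀ i, dist1 (wordFreqVecAt k ω (nseq i)) (q i) ≤ ε := by
  obtain ⟨ω, h1, h2, s, h3, -, h4, h5⟩ := multi_lemma φ P j hspec k ε hε m q hq ω₀ hω₀
  exact ⟨ω, h1, h2, s, h3, h4, fun i => by simpa using h5 i []⟩

end Paper
end

section
/- Let 𝒫 be a number system partition for (M,φ) whose language ℒ fulfills the specification property, and fix k ∈ ℕ. Let E = {x ∈ U_∞ : (P_k^{(1)}(ω_x, n))_{n≥1} has property P}. Then for every r ≥ 1 we have E ⊆ 𝔼_k^{(r)}, i.e. every x ∈ E satisfies A_k^{(r)}(ω_x) = S_k. -/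
open Filter Topology Set

namespace Paper

section Aux

/-- The connecting words of length at most `j`. -/
def Conn {N : ℕ} (L : Set (List (Fin N))) (j : ℕ) (a b : List (Fin N)) : Set (List (Fin N)) :=
  {u | u.length ≤ j ∧ a ++ u ++ b ∈ L}

lemma Conn_finite {N : ℕ} (L : Set (List (Fin N))) (j : ℕ) (a b : List (Fin N)) :
    (Conn L j a b).Finite :=
  (List.finite_length_le (Fin N) j).subset (fun _ hu => hu.1)

lemma exists_sync {N : ℕ} (L : Set (List (Fin N))) (j : ℕ)
    (hfac : ∀ x y z, x ++ y ++ z ∈ L → y ∈ L)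
    (hspec : ∀ a ∈ L, ∀ b ∈ L, ∃ u ∈ L, u.length ≤ j ∧ a ++ u ++ b ∈ L)
    (hne : L.Nonempty) :
    ∃ m n u, m ∈ L ∧ n ∈ L ∧ ∀ x y, x ++ m ∈ L → n ++ y ∈ L → (x ++ m) ++ u ++ (n ++ y) ∈ L := by
  obtain ⟨w0, hw0⟩ := hne
  obtain ⟨⟨m, n⟩, ⟨hm, hn⟩, hmin⟩ :=
    (measure (fun q : List (Fin N) × List (Fin N) => (Conn L j q.1 q.2).ncard)).wf.has_min
      {q | q.1 ∈ L ∧ q.2 ∈ L} ⟨(w0, w0), hw0, hw0⟩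
  obtain ⟨u, -, hu, hmun⟩ := hspec m hm n hn
  refine ⟨m, n, u, hm, hn, fun x y hx hy => ?_⟩
  have hsub : Conn L j (x ++ m) (n ++ y) ⊆ Conn L j m n := by
    rintro v ⟨hv, hv'⟩
    refine ⟨hv, hfac x _ y ?_⟩
    simpa [List.append_assoc] using hv'
  have hle : (Conn L j m n).ncard ≤ (Conn L j (x ++ m) (n ++ y)).ncard := by
    have := hmin (x ++ m, n ++ y) ⟨hx, hy⟩
    exact not_lt.mp this
  have heq := Set.eq_of_subset_of_ncard_le hsub hle (Conn_finite L j m n)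
  have : u ∈ Conn L j (x ++ m) (n ++ y) := by rw [heq]; exact ⟨hu, hmun⟩
  exact this.2

lemma exists_code {N : ℕ} (L : Set (List (Fin N))) (j : ℕ)
    (hfac : ∀ x y z, x ++ y ++ z ∈ L → y ∈ L)
    (hspec : ∀ a ∈ L, ∀ b ∈ L, ∃ u ∈ L, u.length ≤ j ∧ a ++ u ++ b ∈ L)
    (hne : L.Nonempty) :
    ∃ (D : Set (List (Fin N))) (K : ℕ), [] ∈ D ∧ (∀ x ∈ D, ∀ y ∈ D, x ++ y ∈ D) ∧ D ⊆ L ∧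
      ∀ w ∈ L, ∃ x y, x.length ≤ K ∧ y.length ≤ K ∧ x ++ w ++ y ∈ D := by
  obtain ⟨m, n, u, hm, hn, hs⟩ := exists_sync L j hfac hspec hne
  refine ⟨{w | w = [] ∨ ∃ z, n ++ z ++ m ∈ L ∧ w = n ++ z ++ m ++ u},
    n.length + m.length + u.length + j, Or.inl rfl, ?_, ?_, ?_⟩
  · rintro x (rfl | ⟨z, hz, rfl⟩) y (rfl | ⟨z', hz', rfl⟩)
    · left; rfl
    · right; exact ⟨z', hz', by simp⟩
    · right; exact ⟨z, hz, by simp⟩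
    · right
      refine ⟨z ++ m ++ u ++ n ++ z', ?_, by simp [List.append_assoc]⟩
      have := hs (n ++ z) (z' ++ m) hz (by simpa [List.append_assoc] using hz')
      simpa [List.append_assoc] using this
  · rintro x (rfl | ⟨z, hz, rfl⟩)
    · exact hfac [] [] m (by simpa using hm)
    · have := hs (n ++ z) [] hz (by simpa using hn)
      refine hfac [] _ n ?_
      simpa [List.append_assoc] using this
  · intro w hw
    obtain ⟨a, -, ha, haw⟩ := hspec n hn w hw
    obtain ⟨b, -, hb, hbw⟩ := hspec _ haw m hm
    refine ⟨n ++ a, b ++ m ++ u, by simp; omega, by simp; omega, Or.inr ⟨a ++ w ++ b, ?_, ?_⟩⟩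
    · simpa [List.append_assoc] using hbw
    · simp [List.append_assoc]

/-- Number of occurrences of `b` in `w`. -/
noncomputable def occ {N k : ℕ} (w : List (Fin N)) (b : Fin k → Fin N) : ℝ :=
  ∑ i ∈ Finset.range w.length, if (w.drop i).take k = List.ofFn b then (1 : ℝ) else 0

lemma bad_sum (n k : ℕ) (f g : ℕ → Prop) [DecidablePred f] [DecidablePred g]
    (h : ∀ i, i + k ≤ n → (f i ↔ g i)) :
    |∑ i ∈ Finset.range n, (if f i then (1 : ℝ) else 0)
      - ∑ i ∈ Finset.range n, (if g i then (1 : ℝ) else 0)| ≤ k := by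
  rw [← Finset.sum_sub_distrib]
  refine (Finset.abs_sum_le_sum_abs _ _).trans ?_
  calc ∑ i ∈ Finset.range n, |(if f i then (1 : ℝ) else 0) - (if g i then (1 : ℝ) else 0)|
      ≤ ∑ i ∈ Finset.range n, (if n < i + k then (1 : ℝ) else 0) := by
        refine Finset.sum_le_sum fun i _ => ?_
        by_cases hi : n < i + k
        · rw [if_pos hi]
          split_ifs <;> norm_num
        · have := h i (by omega)
          simp [this, hi]
    _ = ((Finset.range n).filter (fun i => n < i + k)).card := by
        rw [Finset.sum_boole]
    _ ≤ k := by
        have : (Finset.range n).filter (fun i => n < i + k) ⊆ Finset.Ico (n - k) n := by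
          intro i hi
          simp at hi ⊢
          omega
        have := Finset.card_le_card this
        simp at this
        exact_mod_cast (by omega)

lemma occ_append {N k : ℕ} (x y : List (Fin N)) (b : Fin k → Fin N) :
    |occ (x ++ y) b - occ x b - occ y b| ≤ k := by
  have h2 : occ (x ++ y) b = (∑ i ∈ Finset.range x.length,
      if ((x ++ y).drop i).take k = List.ofFn b then (1 : ℝ) else 0) + occ y b := by
    unfold occ
    rw [List.length_append, Finset.sum_range_add]
    congr 1
    refine Finset.sum_congr rfl fun i _ => ?_
    rw [List.drop_append, List.drop_eq_nil_of_le (by omega)]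
    simp
  rw [h2]
  have := bad_sum x.length k (fun i => ((x ++ y).drop i).take k = List.ofFn b)
    (fun i => (x.drop i).take k = List.ofFn b) (by
      intro i hi
      rw [List.drop_append_of_le_length (by omega), List.take_append_of_le_length (by simp; omega)])
  unfold occ at *
  convert this using 2
  ring

lemma occ_nonneg {N k : ℕ} (x : List (Fin N)) (b : Fin k → Fin N) : 0 ≤ occ x b := by
  unfold occ
  refine Finset.sum_nonneg fun i _ => ?_
  split_ifs <;> norm_num

lemma occ_le {N k : ℕ} (x : List (Fin N)) (b : Fin k → Fin N) : occ x b ≤ x.length := by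
  unfold occ
  rw [Finset.sum_boole]
  have := Finset.card_filter_le (Finset.range x.length)
    (fun i => (x.drop i).take k = List.ofFn b)
  simp only [Finset.card_range] at this
  exact_mod_cast this

/-- Deviation of the block counts of `w` from `|w| p`. -/
noncomputable def err {N k : ℕ} (p : (Fin k → Fin N) → ℝ) (w : List (Fin N))
    (b : Fin k → Fin N) : ℝ := |occ w b - w.length * p b|

lemma err_append {N k : ℕ} (p : (Fin k → Fin N) → ℝ) (x y : List (Fin N))
    (b : Fin k → Fin N) : err p (x ++ y) b ≤ err p x b + err p y b + k := by
  unfold err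
  have h := occ_append x y b
  rw [List.length_append]
  push_cast
  have : occ (x ++ y) b - (x.length + y.length) * p b =
    (occ x b - x.length * p b) + (occ y b - y.length * p b)
      + (occ (x ++ y) b - occ x b - occ y b) := by ring
  rw [this]
  refine (abs_add_le _ _).trans (add_le_add (abs_add_le _ _) h)

lemma simplex_le_one {α : Type*} [Fintype α] {p : α → ℝ} (hp : p ∈ Simplex α) (b : α) :
    p b ≤ 1 := by
  rw [← hp.2]
  exact Finset.single_le_sum (fun i _ => hp.1 i) (Finset.mem_univ b)

lemma err_le {N k : ℕ} {p : (Fin k → Fin N) → ℝ} (hp : p ∈ Simplex _) (x : List (Fin N))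
    (b : Fin k → Fin N) : err p x b ≤ x.length := by
  unfold err
  have h1 := occ_nonneg x b
  have h2 := occ_le x b
  have h3 := hp.1 b
  have h4 := simplex_le_one hp b
  have h5 : (0 : ℝ) ≤ x.length := Nat.cast_nonneg _
  rw [abs_le]
  constructor <;> nlinarith

/-- The prefix of length `n`. -/
def pre {N : ℕ} (ω : ℕ → Fin N) (n : ℕ) : List (Fin N) := List.ofFn fun m : Fin n => ω (m : ℕ)

lemma pre_length {N : ℕ} (ω : ℕ → Fin N) (n : ℕ) : (pre ω n).length = n := by simp [pre]

lemma freqVec_eq {N k : ℕ} (ω : ℕ → Fin N) (n : ℕ) (b : Fin k → Fin N) :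
    freqVec k ω n b = (∑ i ∈ Finset.range n,
      if (∀ m : Fin k, ω (i + m) = b m) then (1 : ℝ) else 0) / n := by
  unfold freqVec freq
  rw [Finset.sum_boole]
  congr 3
  ext i
  simp only [Finset.mem_filter, Finset.mem_range, and_congr_right_iff]
  intro _
  constructor
  · intro h m
    have h' := congrArg (fun l => l[(m : ℕ)]?) h
    simpa using h'
  · intro h
    apply List.ext_getElem
    · simp
    · intro q h1 h2
      simp only [List.length_ofFn] at h1 h2
      simpa using h ⟨q, h2⟩

lemma occ_pre {N k : ℕ} (ω : ℕ → Fin N) (n : ℕ) (b : Fin k → Fin N) :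
    |occ (pre ω n) b - n * freqVec k ω n b| ≤ k := by
  rcases Nat.eq_zero_or_pos n with rfl | hn
  · simp [occ, pre]
  have hn' : (n : ℝ) ≠ 0 := by positivity
  rw [freqVec_eq, mul_div_cancel₀ _ hn']
  unfold occ
  rw [pre_length]
  apply bad_sum
  intro i hi
  constructor
  · intro h m
    have h' := congrArg (fun l => l[(m : ℕ)]?) h
    have h3 : i + (m : ℕ) < n := by omega
    simpa [pre, List.getElem?_take, List.getElem?_drop, h3] using h'
  · intro h
    apply List.ext_getElem
    · simp [pre]; omega
    · intro q h1 h2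
      simp only [List.length_ofFn] at h2
      simpa [pre] using h ⟨q, h2⟩

lemma freqVec_simplex {N k : ℕ} (ω : ℕ → Fin N) (n : ℕ) (hn : 1 ≤ n) :
    freqVec k ω n ∈ Simplex (Fin k → Fin N) := by
  have hn' : (0 : ℝ) < n := by positivity
  constructor
  · intro b
    rw [freqVec_eq]
    refine div_nonneg (Finset.sum_nonneg fun i _ => ?_) hn'.le
    split_ifs <;> norm_num
  · simp only [freqVec_eq]
    rw [← Finset.sum_div, Finset.sum_comm]
    have : ∀ i ∈ Finset.range n, ∑ b : Fin k → Fin N,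
        (if (∀ m : Fin k, ω (i + m) = b m) then (1 : ℝ) else 0) = 1 := by
      intro i _
      rw [Finset.sum_eq_single (fun m : Fin k => ω (i + m))]
      · simp
      · intro b _ hb
        rw [if_neg]
        intro h
        exact hb (funext fun m => (h m).symm)
      · simp
    rw [Finset.sum_congr rfl this]
    simp [hn'.ne']

lemma exists_limit {N : ℕ} (W : ℕ → List (Fin N)) (hpre : ∀ i, W i <+: W (i + 1))
    (hlen : ∀ i, i ≤ (W i).length) : ∃ ω : ℕ → Fin N, ∀ i, W i = pre ω (W i).length := by
  have hmono : ∀ i i', i ≤ i' → W i <+: W i' := by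
    intro i i' h
    induction h with
    | refl => exact List.prefix_rfl
    | step _ ih => exact ih.trans (hpre _)
  refine ⟨fun n => (W (n + 1))[n]'(by have := hlen (n + 1); omega), fun i => ?_⟩
  apply List.ext_getElem
  · simp [pre]
  · intro q h1 h2
    have hq : q < (W (q + 1)).length := by have := hlen (q + 1); omega
    simp only [pre, List.getElem_ofFn]
    rcases le_total i (q + 1) with h | h
    · exact (hmono _ _ h).getElem h1
    · exact ((hmono _ _ h).getElem hq).symm

lemma accPts_iff {α : Type*} [Fintype α] (f : ℕ → (α → ℝ)) (p : α → ℝ) :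
    p ∈ AccPts f ↔ p ∈ Simplex α ∧
      ∀ ε : ℝ, 0 < ε → ∀ n₀ : ℕ, ∃ n, n₀ ≤ n ∧ ∀ b, |f n b - p b| < ε := by
  unfold AccPts
  refine and_congr_right fun _ => ⟨fun h ε hε n₀ => ?_, fun h ε hε n₀ => ?_⟩
  · obtain ⟨n, hn, hd⟩ := h ε hε n₀
    refine ⟨n, hn, fun b => lt_of_le_of_lt ?_ hd⟩
    exact Finset.single_le_sum (f := fun b => |f n b - p b|) (fun i _ => abs_nonneg _)
      (Finset.mem_univ b)
  · have hc : (0 : ℝ) < Fintype.card α + 1 := by positivity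
    obtain ⟨n, hn, hd⟩ := h (ε / (Fintype.card α + 1)) (by positivity) n₀
    refine ⟨n, hn, ?_⟩
    unfold dist1
    calc ∑ b, |f n b - p b| ≤ ∑ _b : α, ε / (Fintype.card α + 1) :=
          Finset.sum_le_sum fun b _ => (hd b).le
      _ = Fintype.card α * (ε / (Fintype.card α + 1)) := by simp
      _ < ε := by
          rw [← mul_div_assoc, div_lt_iff₀ hc]
          nlinarith

/-- Vectors approximated by the block frequencies of long words. -/
def TT {N : ℕ} (L : Set (List (Fin N))) (k : ℕ) : Set ((Fin k → Fin N) → ℝ) :=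
  {p | p ∈ Simplex (Fin k → Fin N) ∧ ∀ ε : ℝ, 0 < ε → ∀ n₀ : ℕ, ∃ w ∈ L, n₀ ≤ w.length ∧
    ∀ b, err p w b ≤ ε * w.length}

lemma acc_subset_TT {N k : ℕ} {L : Set (List (Fin N))} {ω : ℕ → Fin N}
    (hω : ∀ n, pre ω n ∈ L) : AccPts (freqVec k ω) ⊆ TT L k := by
  intro p hp
  rw [accPts_iff] at hp
  refine ⟨hp.1, fun ε hε n₀ => ?_⟩
  obtain ⟨n₁, hn₁⟩ := exists_nat_ge (2 * k / ε)
  obtain ⟨n, hn, hd⟩ := hp.2 (ε / 2) (by positivity) (max n₀ n₁)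
  refine ⟨pre ω n, hω n, by rw [pre_length]; exact (le_max_left _ _).trans hn, fun b => ?_⟩
  unfold err
  rw [pre_length]
  have h1 := occ_pre ω n b
  have h2 : (n₁ : ℝ) ≤ n := by exact_mod_cast (le_max_right _ _).trans hn
  have h3 : 2 * k ≤ n * ε := by
    rw [← div_le_iff₀ hε]; linarith
  have h4 : |n * freqVec k ω n b - n * p b| ≤ n * (ε / 2) := by
    rw [← mul_sub, abs_mul, Nat.abs_cast]
    exact mul_le_mul_of_nonneg_left (hd b).le (Nat.cast_nonneg _)
  have := abs_sub_le (occ (pre ω n) b) (n * freqVec k ω n b) (n * p b)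
  linarith

lemma TT_code {N k K : ℕ} {L D : Set (List (Fin N))}
    (hext : ∀ w ∈ L, ∃ x y, x.length ≤ K ∧ y.length ≤ K ∧ x ++ w ++ y ∈ D)
    {p : (Fin k → Fin N) → ℝ} (hp : p ∈ TT L k) (ε : ℝ) (hε : 0 < ε) (n₀ : ℕ) :
    ∃ d ∈ D, n₀ ≤ d.length ∧ ∀ b, err p d b + k ≤ ε * d.length := by
  obtain ⟨n₁, hn₁⟩ := exists_nat_ge (2 * (2 * K + 3 * k) / ε)
  obtain ⟨w, hw, hl, he⟩ := hp.2 (ε / 2) (by positivity) (max n₀ n₁)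
  obtain ⟨x, y, hx, hy, hd⟩ := hext w hw
  refine ⟨_, hd, ?_, fun b => ?_⟩
  · have := (le_max_left _ _).trans hl
    simp; omega
  · have h1 := err_append p (x ++ w) y b
    have h2 := err_append p x w b
    have h3 := err_le hp.1 x b
    have h4 := err_le hp.1 y b
    have h5 := he b
    have h6 : (n₁ : ℝ) ≤ w.length := by exact_mod_cast (le_max_right _ _).trans hl
    have h7 : 2 * (2 * K + 3 * k) ≤ w.length * ε := by
      rw [← div_le_iff₀ hε]; linarith
    have hx' : (x.length : ℝ) ≤ K := by exact_mod_cast hx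
    have hy' : (y.length : ℝ) ≤ K := by exact_mod_cast hy
    simp only [List.length_append]
    push_cast
    have h8 : (0 : ℝ) ≤ ε * x.length := by positivity
    have h9 : (0 : ℝ) ≤ ε * y.length := by positivity
    nlinarith

/-- Powers of a word. -/
def wpow {N : ℕ} (d : List (Fin N)) : ℕ → List (Fin N)
  | 0 => []
  | n + 1 => wpow d n ++ d

lemma wpow_length {N : ℕ} (d : List (Fin N)) (n : ℕ) : (wpow d n).length = n * d.length := by
  induction n with
  | zero => simp [wpow]
  | succ n ih => simp [wpow, ih]; ring

lemma wpow_comm {N : ℕ} (d : List (Fin N)) (n : ℕ) : wpow d n ++ d = d ++ wpow d n := by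
  induction n with
  | zero => simp [wpow]
  | succ n ih => simp only [wpow]; rw [ih, List.append_assoc, ih]

lemma wpow_mem {N : ℕ} {D : Set (List (Fin N))} (h0 : [] ∈ D)
    (happ : ∀ x ∈ D, ∀ y ∈ D, x ++ y ∈ D) {d : List (Fin N)} (hd : d ∈ D) (n : ℕ) :
    wpow d n ∈ D := by
  induction n with
  | zero => exact h0
  | succ n ih => exact happ _ ih _ hd

lemma wpow_err {N k : ℕ} (d : List (Fin N)) (p : (Fin k → Fin N) → ℝ) (b : Fin k → Fin N) (n : ℕ) :
    err p (wpow d n) b ≤ n * (err p d b + k) := by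
  induction n with
  | zero => simp [wpow, err, occ]
  | succ n ih =>
    have := err_append p (wpow d n) d b
    simp only [wpow]
    push_cast
    linarith

lemma TT_step {N k K : ℕ} {L D : Set (List (Fin N))} (h0 : [] ∈ D)
    (happ : ∀ x ∈ D, ∀ y ∈ D, x ++ y ∈ D) (hDL : D ⊆ L)
    (hext : ∀ w ∈ L, ∃ x y, x.length ≤ K ∧ y.length ≤ K ∧ x ++ w ++ y ∈ D)
    {p q : (Fin k → Fin N) → ℝ} (hp : p ∈ TT L k) (hq : q ∈ TT L k) (A : ℕ) :
    (fun b => (A * p b + q b) / (A + 1)) ∈ TT L k := by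
  have hA : (0 : ℝ) < A + 1 := by positivity
  refine ⟨⟨fun b => ?_, ?_⟩, fun ε hε n₀ => ?_⟩
  · have := hp.1.1 b
    have := hq.1.1 b
    positivity
  · rw [← Finset.sum_div, Finset.sum_add_distrib, ← Finset.mul_sum, hp.1.2, hq.1.2]
    field_simp
  · obtain ⟨d, hd, hdl, hde⟩ := TT_code hext hp (ε / 2) (by positivity) (n₀ + 1)
    obtain ⟨e, he, hel, hee⟩ := TT_code hext hq (ε / 2) (by positivity) (n₀ + 1)
    have hlen : (wpow d (A * e.length) ++ wpow e d.length).length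
        = (A + 1) * (d.length * e.length) := by
      simp [wpow_length]; ring
    refine ⟨wpow d (A * e.length) ++ wpow e d.length,
      hDL (happ _ (wpow_mem h0 happ hd _) _ (wpow_mem h0 happ he _)), ?_, fun b => ?_⟩
    · rw [hlen]
      nlinarith [Nat.zero_le (A * (d.length * e.length)), Nat.zero_le (n₀ * n₀),
        Nat.mul_le_mul hdl hel]
    · unfold err
      rw [hlen]
      have h1 := occ_append (wpow d (A * e.length)) (wpow e d.length) b
      have h2 := wpow_err d p b (A * e.length)
      have h3 := wpow_err e q b d.length
      unfold err at h2 h3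
      rw [wpow_length] at h2 h3
      have h4 : ((A * e.length : ℕ) : ℝ) * (|occ d b - d.length * p b| + k) ≤
          ((A * e.length : ℕ) : ℝ) * (ε / 2 * d.length) :=
        mul_le_mul_of_nonneg_left (hde b) (Nat.cast_nonneg _)
      have h5 : (d.length : ℝ) * (|occ e b - e.length * q b| + k) ≤
          (d.length : ℝ) * (ε / 2 * e.length) :=
        mul_le_mul_of_nonneg_left (hee b) (Nat.cast_nonneg _)
      have h6 : (k : ℝ) ≤ ε / 2 * d.length := by
        have := hde b
        have : 0 ≤ err p d b := abs_nonneg _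
        linarith
      have hd1 : (1 : ℝ) ≤ d.length := by exact_mod_cast (by omega : 1 ≤ d.length)
      have he1 : (1 : ℝ) ≤ e.length := by exact_mod_cast (by omega : 1 ≤ e.length)
      have h7 : ε / 2 * d.length ≤ ε / 2 * ((A + 1) * (d.length * e.length)) := by
        refine mul_le_mul_of_nonneg_left ?_ (by positivity)
        have : (1 : ℝ) ≤ (A + 1) * e.length := by
          have : (0 : ℝ) ≤ A * e.length := by positivity
          nlinarith
        nlinarith
      push_cast at *
      have hid : occ (wpow d (A * e.length) ++ wpow e d.length) b
          - (A + 1) * (d.length * e.length) * ((A * p b + q b) / (A + 1))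
          = (occ (wpow d (A * e.length) ++ wpow e d.length) b
              - occ (wpow d (A * e.length)) b - occ (wpow e d.length) b)
            + (occ (wpow d (A * e.length)) b - A * e.length * d.length * p b)
            + (occ (wpow e d.length) b - d.length * e.length * q b) := by
        field_simp
        ring
      rw [hid]
      refine (abs_add_three _ _ _).trans ?_
      nlinarith

lemma pre_of_W {N : ℕ} {L : Set (List (Fin N))}
    (hfac : ∀ x y z, x ++ y ++ z ∈ L → y ∈ L) {W : ℕ → List (Fin N)} (hW : ∀ i, W i ∈ L)
    (hlen : ∀ i, i ≤ (W i).length) {ω : ℕ → Fin N} (hω : ∀ i, W i = pre ω (W i).length) (n : ℕ) :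
    pre ω n ∈ L := by
  have h : pre ω n <+: W n := by
    rw [hω n, List.prefix_iff_eq_take]
    apply List.ext_getElem
    · simp [pre, hlen n]
    · intro i h1 h2
      simp [pre]
  obtain ⟨t, ht⟩ := h
  refine hfac [] _ t ?_
  simpa [ht] using hW n

lemma TT_subset {N k K : ℕ} {L D : Set (List (Fin N))} (h0 : [] ∈ D)
    (hfac : ∀ x y z, x ++ y ++ z ∈ L → y ∈ L)
    (happ : ∀ x ∈ D, ∀ y ∈ D, x ++ y ∈ D) (hDL : D ⊆ L)
    (hext : ∀ w ∈ L, ∃ x y, x.length ≤ K ∧ y.length ≤ K ∧ x ++ w ++ y ∈ D)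
    {p : (Fin k → Fin N) → ℝ} (hp : p ∈ TT L k) :
    ∃ ω, (∀ n, pre ω n ∈ L) ∧ p ∈ AccPts (freqVec k ω) := by
  have hstep : ∀ (i : ℕ) (w : D), ∃ w' : D, w.1 <+: w'.1 ∧ w.1.length < w'.1.length ∧
      ∀ b, err p w'.1 b ≤ 1 / (i + 1) * w'.1.length := by
    rintro i ⟨w, hw⟩
    obtain ⟨n₁, hn₁⟩ := exists_nat_ge (2 * w.length * (i + 1) : ℝ)
    obtain ⟨d, hd, hdl, hde⟩ := TT_code hext hp (1 / (2 * (i + 1))) (by positivity) (n₁ + 1)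
    refine ⟨⟨w ++ d, happ _ hw _ hd⟩, List.prefix_append _ _, by simp; omega, fun b => ?_⟩
    have h1 := err_append p w d b
    have h2 := err_le hp.1 w b
    have h3 := hde b
    have h4 : (n₁ + 1 : ℝ) ≤ d.length := by exact_mod_cast hdl
    simp only [List.length_append]
    push_cast
    have h5 : (w.length : ℝ) ≤ 1 / (2 * (i + 1)) * d.length := by
      rw [div_mul_eq_mul_div, le_div_iff₀ (by positivity)]
      linarith
    have h6 : (1 : ℝ) / (i + 1) * (w.length + d.length) =
      1 / (i + 1) * w.length + 1 / (2 * (i + 1)) * d.length + 1 / (2 * (i + 1)) * d.length := by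
      field_simp; ring
    have h7 : (0 : ℝ) ≤ 1 / (i + 1) * w.length := by positivity
    rw [h6]
    linarith
  choose g hg1 hg2 hg3 using hstep
  let W : ℕ → D := fun n => Nat.rec ⟨[], h0⟩ (fun i w => g i w) n
  have hlen : ∀ i, i ≤ (W i).1.length := by
    intro i
    induction i with
    | zero => simp
    | succ i ih => exact lt_of_le_of_lt ih (hg2 i (W i))
  obtain ⟨ω, hω⟩ := exists_limit (fun i => (W i).1) (fun i => hg1 i (W i)) hlen
  refine ⟨ω, pre_of_W hfac (fun i => hDL (W i).2) hlen hω, ?_⟩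
  rw [accPts_iff]
  refine ⟨hp.1, fun ε hε n₀ => ?_⟩
  obtain ⟨n₁, hn₁⟩ := exists_nat_gt ((k + 2) / ε)
  set i := max n₀ n₁ with hi
  refine ⟨(W (i + 1)).1.length, ?_, fun b => ?_⟩
  · have := hlen (i + 1)
    have := le_max_left n₀ n₁
    omega
  · have h1 := hg3 i (W i) b
    change err p (W (i + 1)).1 b ≤ 1 / (i + 1) * (W (i + 1)).1.length at h1
    have h2 := occ_pre ω (W (i + 1)).1.length b
    rw [← hω (i + 1)] at h2
    unfold err at h1
    set n := (W (i + 1)).1.length with hn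
    have h3 : i + 1 ≤ n := hlen (i + 1)
    have h3' : (i + 1 : ℝ) ≤ n := by exact_mod_cast h3
    have h4 : (n₁ : ℝ) ≤ i := by exact_mod_cast le_max_right n₀ n₁
    have hn0 : (0 : ℝ) < n := by have : (0 : ℝ) ≤ i := Nat.cast_nonneg _; linarith
    have h5 : n * |freqVec k ω n b - p b| ≤ k + 1 / (i + 1) * n := by
      rw [← Nat.abs_cast n, ← abs_mul, mul_sub, Nat.abs_cast]
      have := abs_sub_le (n * freqVec k ω n b) (occ (W (i + 1)).1 b) (n * p b)
      rw [abs_sub_comm (n * freqVec k ω n b) (occ _ b)] at this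
      linarith
    have h6 : k + 2 < ε * i := by
      rw [div_lt_iff₀ hε] at hn₁
      nlinarith
    have h7 : (1 : ℝ) / (i + 1) * n * (i + 1) = n := by field_simp
    by_contra hcon
    push Not at hcon
    have h8 : n * ε ≤ k + 1 / (i + 1) * n :=
      (mul_le_mul_of_nonneg_left hcon hn0.le).trans h5
    have hi0 : (0 : ℝ) ≤ i := Nat.cast_nonneg _
    have h9 : n * ε * (i + 1) ≤ k * (i + 1) + n := by nlinarith
    have h10 : (k : ℝ) * (i + 1) ≤ k * n := mul_le_mul_of_nonneg_left h3' (Nat.cast_nonneg _)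
    nlinarith

lemma sum_periodic (f : ℕ → ℝ) (d : ℕ) (hf : ∀ n, f (n + d) = f n) (i : ℕ) :
    ∑ x ∈ Finset.range (i * d), f x = i * ∑ x ∈ Finset.range d, f x := by
  have hf' : ∀ i n, f (i * d + n) = f n := by
    intro i n
    induction i with
    | zero => simp
    | succ i ih => rw [← ih, ← hf (i * d + n)]; congr 1; ring
  induction i with
  | zero => simp
  | succ i ih =>
    rw [add_mul, one_mul, Finset.sum_range_add, ih]
    simp only [hf']
    push_cast
    ring

lemma rat_dense {N k K : ℕ} {L D : Set (List (Fin N))} (h0 : [] ∈ D)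
    (hfac : ∀ x y z, x ++ y ++ z ∈ L → y ∈ L)
    (happ : ∀ x ∈ D, ∀ y ∈ D, x ++ y ∈ D) (hDL : D ⊆ L)
    (hext : ∀ w ∈ L, ∃ x y, x.length ≤ K ∧ y.length ≤ K ∧ x ++ w ++ y ∈ D)
    {p : (Fin k → Fin N) → ℝ} (hp : p ∈ TT L k) (ε : ℝ) (hε : 0 < ε) :
    ∃ ω, (∀ n, pre ω n ∈ L) ∧ ∃ q ∈ AccPts (freqVec k ω), (∀ b, ∃ a : ℚ, q b = (a : ℝ)) ∧
      ∀ b, |q b - p b| < ε := by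
  obtain ⟨d, hd, hdl, hde⟩ := TT_code hext hp (ε / 2) (by positivity) 1
  have hlen : ∀ i, i ≤ (wpow d i).length := by
    intro i; rw [wpow_length]; nlinarith
  obtain ⟨ω, hω⟩ := exists_limit (wpow d) (fun i => List.prefix_append _ _) hlen
  have hget : ∀ i n (h : n < (wpow d i).length), (wpow d i)[n] = ω n := by
    intro i n h
    have h1 := congrArg (fun l => l[n]?) (hω i)
    simp only [List.getElem?_eq_getElem h] at h1
    rw [List.getElem?_eq_getElem (by rw [pre_length]; exact h)] at h1
    simpa [pre] using h1
  have hper : ∀ n, ω (n + d.length) = ω n := by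
    intro n
    have h1 : n < (wpow d (n + 1)).length := hlen (n + 1)
    have h2 : n + d.length < (wpow d (n + 2)).length := by
      rw [wpow_length] at h1 ⊢; nlinarith
    rw [← hget (n + 1) n h1, ← hget (n + 2) _ h2]
    have h3 : wpow d (n + 2) = d ++ wpow d (n + 1) := wpow_comm d (n + 1)
    simp only [h3]
    rw [List.getElem_append_right (by omega)]
    simp
  have hd0 : (0 : ℝ) < d.length := by exact_mod_cast hdl
  refine ⟨ω, pre_of_W hfac (fun i => hDL (wpow_mem h0 happ hd i)) hlen hω,
    freqVec k ω d.length, ?_, ?_, ?_⟩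
  · rw [accPts_iff]
    refine ⟨freqVec_simplex ω _ hdl, fun ε hε n₀ => ⟨(n₀ + 1) * d.length, by nlinarith, ?_⟩⟩
    intro b
    have : freqVec k ω ((n₀ + 1) * d.length) b = freqVec k ω d.length b := by
      rw [freqVec_eq, freqVec_eq, sum_periodic]
      · push_cast
        field_simp
      · intro n
        have : ∀ m : Fin k, ω (n + d.length + m) = ω (n + m) := by
          intro m
          rw [← hper (n + m)]; congr 1; ring
        simp only [this]
    rw [this]
    simpa using hε
  · intro b
    unfold freqVec freq
    exact ⟨(_ : ℕ) / (d.length : ℕ), by push_cast; rfl⟩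
  · intro b
    have h1 := occ_pre ω d.length b
    have h2 : pre ω d.length = d := by
      have := hω 1
      simp only [wpow, List.nil_append] at this
      exact this.symm
    rw [h2] at h1
    have h3 := hde b
    unfold err at h3
    have h5 : d.length * |freqVec k ω d.length b - p b| ≤ ε / 2 * d.length := by
      rw [← Nat.abs_cast d.length, ← abs_mul, mul_sub, Nat.abs_cast]
      have := abs_sub_le (d.length * freqVec k ω d.length b) (occ d b) (d.length * p b)
      rw [abs_sub_comm (d.length * freqVec k ω d.length b) (occ d b)] at this
      linarith
    nlinarith

lemma TT_closed {N k : ℕ} (L : Set (List (Fin N))) {p : (Fin k → Fin N) → ℝ}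
    (hp : p ∈ Simplex _) (h : ∀ ε : ℝ, 0 < ε → ∃ q ∈ TT L k, ∀ b, |q b - p b| ≤ ε) :
    p ∈ TT L k := by
  refine ⟨hp, fun ε hε n₀ => ?_⟩
  obtain ⟨q, hq, hqp⟩ := h (ε / 2) (by positivity)
  obtain ⟨w, hw, hl, he⟩ := hq.2 (ε / 2) (by positivity) n₀
  refine ⟨w, hw, hl, fun b => ?_⟩
  have h1 := he b
  unfold err at *
  have h2 : |w.length * q b - w.length * p b| ≤ w.length * (ε / 2) := by
    rw [← mul_sub, abs_mul, Nat.abs_cast]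
    exact mul_le_mul_of_nonneg_left (hqp b) (Nat.cast_nonneg _)
  have := abs_sub_le (occ w b) (w.length * q b) (w.length * p b)
  linarith

lemma cesaro_bound (e : ℕ → ℝ) (j n : ℕ) (ε : ℝ) (hε : 0 ≤ ε) (h1 : ∀ i, |e i| ≤ 1)
    (h2 : ∀ i, j < i → i ≤ n → |e i| ≤ ε) : |∑ i ∈ Finset.Icc 1 n, e i| ≤ j + ε * n := by
  refine (Finset.abs_sum_le_sum_abs _ _).trans ?_
  calc ∑ i ∈ Finset.Icc 1 n, |e i|
      ≤ ∑ i ∈ Finset.Icc 1 n, ((if i ≤ j then (1 : ℝ) else 0) + ε) := by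
        refine Finset.sum_le_sum fun i hi => ?_
        by_cases hij : i ≤ j
        · rw [if_pos hij]; linarith [h1 i]
        · rw [if_neg hij, zero_add]
          exact h2 i (by omega) (Finset.mem_Icc.mp hi).2
    _ = ((Finset.Icc 1 n).filter (fun i => i ≤ j)).card + ε * n := by
        rw [Finset.sum_add_distrib, Finset.sum_boole]
        simp [mul_comm]
    _ ≤ j + ε * n := by
        have : (Finset.Icc 1 n).filter (fun i => i ≤ j) ⊆ Finset.Icc 1 j := by
          intro i hi
          simp at hi ⊢
          omega
        have := Finset.card_le_card this
        simp at this
        have : (((Finset.Icc 1 n).filter (fun i => i ≤ j)).card : ℝ) ≤ j := by exact_mod_cast this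
        linarith

lemma cfreq_bounds {N k : ℕ} (r : ℕ) (ω : ℕ → Fin N) (n : ℕ) (b : Fin k → Fin N) :
    0 ≤ cfreqVec r k ω n b ∧ cfreqVec r k ω n b ≤ 1 := by
  induction r generalizing n with
  | zero =>
    change 0 ≤ freqVec k ω n b ∧ freqVec k ω n b ≤ 1
    rcases Nat.eq_zero_or_pos n with rfl | hn
    · simp [freqVec, freq]
    · exact ⟨(freqVec_simplex ω n hn).1 b, simplex_le_one (freqVec_simplex ω n hn) b⟩
  | succ r ih =>
    change 0 ≤ (∑ j ∈ Finset.Icc 1 n, cfreqVec r k ω j b) / n ∧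
      (∑ j ∈ Finset.Icc 1 n, cfreqVec r k ω j b) / n ≤ 1
    refine ⟨div_nonneg (Finset.sum_nonneg fun i _ => (ih i).1) (Nat.cast_nonneg _), ?_⟩
    refine div_le_one_of_le₀ ?_ (Nat.cast_nonneg _)
    calc ∑ j ∈ Finset.Icc 1 n, cfreqVec r k ω j b ≤ ∑ j ∈ Finset.Icc 1 n, (1 : ℝ) :=
          Finset.sum_le_sum fun i _ => (ih i).2
      _ = n := by simp

lemma abs_sub_le_one {a b : ℝ} (ha : 0 ≤ a ∧ a ≤ 1) (hb : 0 ≤ b ∧ b ≤ 1) : |a - b| ≤ 1 := by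
  rw [abs_le]; constructor <;> linarith [ha.1, ha.2, hb.1, hb.2]

lemma near_TT_zero {N k : ℕ} {L : Set (List (Fin N))} {ω : ℕ → Fin N}
    (hω : ∀ n, pre ω n ∈ L) (ε : ℝ) (hε : 0 < ε) :
    ∃ n₀ : ℕ, ∀ n, n₀ ≤ n → ∃ t ∈ TT L k, ∀ b, |freqVec k ω n b - t b| ≤ ε := by
  by_contra hcon
  push Not at hcon
  choose g hg1 hg2 using fun i : ℕ => hcon (i + 1)
  have hmem : ∀ i, freqVec k ω (g i) ∈ stdSimplex ℝ (Fin k → Fin N) :=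
    fun i => freqVec_simplex ω (g i) (by have := hg1 i; omega)
  obtain ⟨p, hp, θ, hθ, hlim⟩ := (isCompact_stdSimplex ℝ (Fin k → Fin N)).tendsto_subseq hmem
  have hacc : ∀ ε : ℝ, 0 < ε → ∃ i₀, ∀ i, i₀ ≤ i → ∀ b, |freqVec k ω (g (θ i)) b - p b| < ε := by
    intro ε hε
    obtain ⟨i₀, h⟩ := Metric.tendsto_atTop.mp hlim ε hε
    refine ⟨i₀, fun i hi b => lt_of_le_of_lt ?_ (h i hi)⟩
    exact dist_le_pi_dist (freqVec k ω (g (θ i))) p b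
  have hpT : p ∈ TT L k := by
    apply acc_subset_TT hω
    rw [accPts_iff]
    refine ⟨hp, fun ε hε n₀ => ?_⟩
    obtain ⟨i₀, h⟩ := hacc ε hε
    refine ⟨g (θ (max i₀ n₀)), ?_, h _ (le_max_left _ _)⟩
    have h1 := hg1 (θ (max i₀ n₀))
    have h2 := hθ.id_le (max i₀ n₀)
    have h3 := le_max_right i₀ n₀
    simp only [id] at h2
    omega
  obtain ⟨i₀, h⟩ := hacc ε hε
  obtain ⟨b, hb⟩ := hg2 (θ i₀) p hpT
  exact absurd (h i₀ le_rfl b) (not_lt.mpr hb.le)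

lemma TT_avg {N k K : ℕ} {L D : Set (List (Fin N))} (h0 : [] ∈ D)
    (happ : ∀ x ∈ D, ∀ y ∈ D, x ++ y ∈ D) (hDL : D ⊆ L)
    (hext : ∀ w ∈ L, ∃ x y, x.length ≤ K ∧ y.length ≤ K ∧ x ++ w ++ y ∈ D)
    (t : ℕ → (Fin k → Fin N) → ℝ) (ht : ∀ i, t i ∈ TT L k) (n : ℕ) :
    (fun b => (∑ i ∈ Finset.Icc 1 (n + 1), t i b) / ((n + 1 : ℕ) : ℝ)) ∈ TT L k := by
  induction n with
  | zero => simpa using ht 1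
  | succ n ih =>
    have := TT_step h0 happ hDL hext ih (ht (n + 2)) (n + 1)
    convert this using 2 with b
    rw [Finset.sum_Icc_succ_top (by omega)]
    push_cast
    field_simp

lemma near_TT {N k K : ℕ} {L D : Set (List (Fin N))} (h0 : [] ∈ D)
    (happ : ∀ x ∈ D, ∀ y ∈ D, x ++ y ∈ D) (hDL : D ⊆ L)
    (hext : ∀ w ∈ L, ∃ x y, x.length ≤ K ∧ y.length ≤ K ∧ x ++ w ++ y ∈ D)
    {ω : ℕ → Fin N} (hω : ∀ n, pre ω n ∈ L) (r : ℕ) :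
    ∀ ε : ℝ, 0 < ε → ∃ n₀ : ℕ, ∀ n, n₀ ≤ n → ∃ t ∈ TT L k,
      ∀ b, |cfreqVec r k ω n b - t b| ≤ ε := by
  induction r with
  | zero => exact fun ε hε => near_TT_zero hω ε hε
  | succ r ih =>
    intro ε hε
    obtain ⟨n₁, hn₁⟩ := ih (ε / 2) (by positivity)
    obtain ⟨t₀, ht₀, -⟩ := hn₁ n₁ le_rfl
    have : ∀ n, ∃ t ∈ TT L k, n₁ ≤ n → ∀ b, |cfreqVec r k ω n b - t b| ≤ ε / 2 := by
      intro n
      by_cases hn : n₁ ≤ n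
      · obtain ⟨t, ht, h⟩ := hn₁ n hn
        exact ⟨t, ht, fun _ => h⟩
      · exact ⟨t₀, ht₀, fun h => absurd h hn⟩
    choose t ht htn using this
    obtain ⟨n₂, hn₂⟩ := exists_nat_ge (2 * n₁ / ε)
    refine ⟨n₂ + 1, fun n hn => ?_⟩
    obtain ⟨n, rfl⟩ : ∃ n', n = n' + 1 := ⟨n - 1, by omega⟩
    refine ⟨_, TT_avg h0 happ hDL hext t ht n, fun b => ?_⟩
    change |(∑ j ∈ Finset.Icc 1 (n + 1), cfreqVec r k ω j b) / ((n + 1 : ℕ) : ℝ) -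
      (∑ i ∈ Finset.Icc 1 (n + 1), t i b) / ((n + 1 : ℕ) : ℝ)| ≤ ε
    have hpos : (0 : ℝ) < ((n + 1 : ℕ) : ℝ) := by positivity
    rw [← sub_div, ← Finset.sum_sub_distrib, abs_div, abs_of_pos hpos, div_le_iff₀ hpos]
    have h1 := cesaro_bound (fun j => cfreqVec r k ω j b - t j b) n₁ (n + 1) (ε / 2)
      (by positivity) (fun i => abs_sub_le_one (cfreq_bounds r ω i b)
        ⟨(ht i).1.1 b, simplex_le_one (ht i).1 b⟩) (fun i hi _ => htn i hi.le b)
    have h2 : ((n₂ + 1 : ℕ) : ℝ) ≤ ((n + 1 : ℕ) : ℝ) := by exact_mod_cast hn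
    rw [div_le_iff₀ hε] at hn₂
    have h3 : (n₂ : ℝ) ≤ ((n + 1 : ℕ) : ℝ) := by push_cast at h2 ⊢; linarith
    have h4 : n₂ * ε ≤ ((n + 1 : ℕ) : ℝ) * ε := mul_le_mul_of_nonneg_right h3 hε.le
    linarith

lemma tow_succ (m x : ℕ) : tow (m + 1) x = tow m (2 ^ x) := rfl

lemma tow_mono (m : ℕ) {x y : ℕ} (h : x ≤ y) : tow m x ≤ tow m y := by
  induction m generalizing x y with
  | zero => exact h
  | succ m ih =>
    rw [tow_succ, tow_succ]
    exact ih (Nat.pow_le_pow_right (by norm_num) h)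

lemma near_q {N k : ℕ} {ω : ℕ → Fin N} {q : (Fin k → Fin N) → ℝ} (hq : q ∈ Simplex _)
    (h1 : ∀ m i : ℕ, ∀ ε : ℝ, 1 ≤ m → 0 < ε → ∃ s, i ≤ s ∧ ∀ n, s < n → n < tow m s →
        ∀ b, |cfreqVec 1 k ω n b - q b| ≤ ε) (r : ℕ) (hr : 1 ≤ r) :
    ∀ m i : ℕ, ∀ ε : ℝ, 1 ≤ m → 0 < ε → ∃ s, i ≤ s ∧ ∀ n, s < n → n < tow m s →
        ∀ b, |cfreqVec r k ω n b - q b| ≤ ε := by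
  induction r, hr using Nat.le_induction with
  | base => exact h1
  | succ r _ ih =>
    intro m i ε hm hε
    have hlim : Tendsto (fun n : ℕ => (n : ℝ) / 2 ^ n) atTop (𝓝 0) := by
      simpa using tendsto_pow_const_div_const_pow_of_one_lt 1 (one_lt_two : (1 : ℝ) < 2)
    obtain ⟨i₁, hi₁⟩ := eventually_atTop.mp (hlim.eventually_lt_const (half_pos hε))
    obtain ⟨s, hs, h⟩ := ih (m + 1) (max i i₁) (ε / 2) (by omega) (by positivity)
    refine ⟨2 ^ s, ((le_max_left _ _).trans hs).trans Nat.lt_two_pow_self.le, ?_⟩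
    intro n hn hn' b
    change |(∑ j ∈ Finset.Icc 1 n, cfreqVec r k ω j b) / n - q b| ≤ ε
    have hn2 : (2 : ℝ) ^ s < n := by exact_mod_cast hn
    have hpos : (0 : ℝ) < n := lt_trans (by positivity) hn2
    have heq : (∑ j ∈ Finset.Icc 1 n, cfreqVec r k ω j b) / n - q b =
        (∑ j ∈ Finset.Icc 1 n, (cfreqVec r k ω j b - q b)) / n := by
      rw [Finset.sum_sub_distrib]
      simp
      field_simp
    rw [heq, abs_div, abs_of_pos hpos, div_le_iff₀ hpos]
    have h2 := cesaro_bound (fun j => cfreqVec r k ω j b - q b) s n (ε / 2)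
      (by positivity) (fun i => abs_sub_le_one (cfreq_bounds r ω i b)
        ⟨hq.1 b, simplex_le_one hq b⟩) (fun i hi hi' => h i hi (by
          rw [tow_succ]; exact lt_of_le_of_lt hi' hn') b)
    have h3 := hi₁ s ((le_max_right _ _).trans hs)
    rw [div_lt_iff₀ (by positivity)] at h3
    have h4 : ε / 2 * 2 ^ s ≤ ε / 2 * n := mul_le_mul_of_nonneg_left hn2.le (by positivity)
    linarith

lemma lang_factor {N : ℕ} {M : Type*} (φ : M → M) (P : Fin N → Set M)
    [MetricSpace M] (a b c : List (Fin N)) (h : a ++ b ++ c ∈ Lang φ P) : b ∈ Lang φ P := by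
  obtain ⟨y, hy⟩ := h
  refine ⟨φ^[a.length] y, ?_⟩
  simp only [Set.mem_iInter, Set.mem_preimage] at hy ⊢
  intro m
  have h1 := hy ⟨a.length + m, by simp; omega⟩
  rw [← Function.iterate_add_apply]
  have h2 : (a ++ b ++ c).get ⟨a.length + m, by simp; omega⟩ = b.get m := by
    simp
  rw [h2] at h1
  have h3 : (m : ℕ) + 1 + a.length = a.length + m + 1 := by omega
  rw [h3]
  exact h1

end Aux

/-- the set `E` is contained in `𝔼_k^{(r)}` for every `r ≥ 1`:
every `x ∈ U_∞` whose sequence of first Cesàro averages has property `P`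
satisfies `A_k^{(r)}(ω_x) = S_k`. -/
theorem E_subset_Ekr
    {N : ℕ}
    {M : Type*} [MetricSpace M] [CompactSpace M]
    (φ : M → M) (P : Fin N → Set M)
    (hNSP : IsNSP φ P)
    (j : ℕ) (hspec : Spec φ P j)
    (π : (ℕ → Fin N) → M)
    (hπ : ∀ ω ∈ ShiftSpace φ P, (⋂ n : ℕ, closure (Dn φ P ω n)) = {π ω})
    (symb : M → (ℕ → Fin N))
    (hsymb : ∀ x ∈ Uinf φ P, symb x ∈ ShiftSpace φ P ∧ π (symb x) = x)
    (k : ℕ) (hk : 1 ≤ k)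
    (r : ℕ) (hr : 1 ≤ r) :
    ∀ x ∈ Uinf φ P, HasPropP φ P (cfreqVec 1 k (symb x)) →
      AccPts (cfreqVec r k (symb x)) = SK φ P k := by
  intro x hx hP
  obtain ⟨hω, -⟩ := hsymb x hx
  set ω := symb x with hωdef
  have hω' : ∀ n, pre ω n ∈ Lang φ P := hω
  have hfac : ∀ a b c, a ++ b ++ c ∈ Lang φ P → b ∈ Lang φ P := lang_factor φ P
  obtain ⟨D, K, h0, happ, hDL, hext⟩ := exists_code (Lang φ P) j hfac hspec ⟨_, hω' 0⟩
  have hSK : SK φ P k = TT (Lang φ P) k := by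
    apply Set.Subset.antisymm
    · intro p hp
      simp only [SK, Set.mem_iUnion] at hp
      obtain ⟨η, hη, hp⟩ := hp
      exact acc_subset_TT hη hp
    · intro p hp
      obtain ⟨η, hη, hp⟩ := TT_subset h0 hfac happ hDL hext hp
      simp only [SK, Set.mem_iUnion]
      exact ⟨η, hη, hp⟩
  apply Set.Subset.antisymm
  · intro p hp
    rw [accPts_iff] at hp
    rw [hSK]
    refine TT_closed _ hp.1 fun ε hε => ?_
    obtain ⟨n₀, hn₀⟩ := near_TT h0 happ hDL hext hω' r (ε / 2) (by positivity)
    obtain ⟨n, hn, hnp⟩ := hp.2 (ε / 2) (by positivity) n₀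
    obtain ⟨t, ht, htn⟩ := hn₀ n hn
    refine ⟨t, ht, fun b => ?_⟩
    have h1 := abs_sub_le (t b) (cfreqVec r k ω n b) (p b)
    have h2 := htn b
    rw [abs_sub_comm] at h2
    linarith [hnp b]
  · intro p hp
    rw [hSK] at hp
    rw [accPts_iff]
    refine ⟨hp.1, fun ε hε n₀ => ?_⟩
    obtain ⟨η, hη, q, hq, hrat, hqp⟩ := rat_dense h0 hfac happ hDL hext hp (ε / 2) (by positivity)
    have hqD : q ∈ DD φ P k := by
      refine ⟨?_, hrat⟩
      simp only [SK, Set.mem_iUnion]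
      exact ⟨η, hη, hq⟩
    have hP1 : ∀ m i : ℕ, ∀ ε : ℝ, 1 ≤ m → 0 < ε → ∃ s, i ≤ s ∧ ∀ n, s < n → n < tow m s →
        ∀ b, |cfreqVec 1 k ω n b - q b| ≤ ε := by
      intro m i ε hm hε
      obtain ⟨s, hs, -, h⟩ := hP q hqD m hm i ε hε
      refine ⟨s, hs, fun n hn hn' b => ?_⟩
      have h1 := h n hn (lt_of_lt_of_le hn' (tow_mono m Nat.lt_two_pow_self.le))
      refine le_trans ?_ h1.le
      exact Finset.single_le_sum (f := fun b => |cfreqVec 1 k ω n b - q b|)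
        (fun i _ => abs_nonneg _) (Finset.mem_univ b)
    obtain ⟨s, hs, h⟩ := near_q hq.1 hP1 r hr 1 (n₀ + 2) (ε / 2) le_rfl (by positivity)
    refine ⟨s + 1, by omega, fun b => ?_⟩
    have h1 := h (s + 1) (by omega) (by
      change s + 1 < 2 ^ s
      obtain ⟨c, rfl⟩ : ∃ c, s = c + 2 := ⟨s - 2, by omega⟩
      have : c < 2 ^ c := Nat.lt_two_pow_self
      rw [pow_add]
      omega) b
    have h2 := abs_sub_le (cfreqVec r k ω (s + 1) b) (q b) (p b)
    linarith [hqp b]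

end Paper
end

section
/- Let N ≥ 2 be an integer. The set of extremely non-normal numbers in base N — that is, the set of x ∈ [0,1) such that for every k ≥ 1 the set of accumulation points (with respect to the ℓ¹-norm) of the sequence (Π_k(x,n))_{n≥1} equals the set S_k of shift-invariant probability vectors indexed by {0,…,N−1}^k — is residual in [0,1). -/
open Filter Topology Set

namespace BaseN

/-- The ℓ¹ distance between two finitely-indexed real vectors. -/
noncomputable def dist1 {α : Type*} [Fintype α] (p q : α → ℝ) : ℝ :=
  ∑ b, |p b - q b|

/-- The simplex of probability vectors indexed by `α`. -/
def Simplex (α : Type*) [Fintype α] : Set (α → ℝ) :=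
  {p | (∀ b, 0 ≤ p b) ∧ ∑ b, p b = 1}

/-- The set of accumulation points, in the simplex with the ℓ¹ norm, of a sequence
of vectors. -/
def AccPts {α : Type*} [Fintype α] (f : ℕ → (α → ℝ)) : Set (α → ℝ) :=
  {p | p ∈ Simplex α ∧ ∀ ε : ℝ, 0 < ε → ∀ n₀ : ℕ, ∃ n, n₀ ≤ n ∧ dist1 (f n) p < ε}

/-- `d : ℝ → ℕ → Fin N` assigns to each `x ∈ [0,1)` the digit sequence
`d x 0, d x 1, …` (so `d x h = d_{h+1}(x)`) of its unique non-terminating base-`N`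
expansion: the digits sum to `x`, and for `x ≠ 0` the digit sequence is not
eventually zero. -/
def IsNonTerminatingDigits {N : ℕ} (d : ℝ → ℕ → Fin N) : Prop :=
  ∀ x ∈ Set.Ico (0 : ℝ) 1,
    HasSum (fun h : ℕ => (d x h : ℝ) / (N : ℝ) ^ (h + 1)) x ∧
    (x ≠ 0 → ∀ H : ℕ, ∃ h, H ≤ h ∧ (d x h : ℕ) ≠ 0)

/-- `bfreq d x b n` is the frequency `Π(x,b,n)` of the block `b` among the first
`n` digits of `x`. -/
noncomputable def bfreq {N : ℕ} (d : ℝ → ℕ → Fin N) (x : ℝ) (b : List (Fin N))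
    (n : ℕ) : ℝ :=
  (((Finset.range n).filter fun i =>
      (List.ofFn fun m : Fin b.length => d x (i + (m : ℕ))) = b).card : ℝ) / n

/-- `Π_k(x,n)`: the vector of frequencies of all blocks of length `k` among the
first `n` digits of `x`. -/
noncomputable def bfreqVec {N : ℕ} (d : ℝ → ℕ → Fin N) (x : ℝ) (k n : ℕ) :
    (Fin k → Fin N) → ℝ :=
  fun b => bfreq d x (List.ofFn b) n

/-- The set `S_k` (for `k = j+1`) of shift-invariant probability vectors indexed
by blocks of length `j+1`. -/
def ShiftInvariant {N : ℕ} (j : ℕ) : Set ((Fin (j + 1) → Fin N) → ℝ) :=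
  {p | p ∈ Simplex (Fin (j + 1) → Fin N) ∧
    ∀ b : Fin j → Fin N,
      ∑ i : Fin N, p (Fin.cons i b) = ∑ i : Fin N, p (Fin.snoc b i)}

set_option linter.unusedSectionVars false

section Comb

variable {A : Type*} [Fintype A] [DecidableEq A]

/-- window -/
def win (s : ℕ → A) (k i : ℕ) : Fin k → A := fun m => s (i + m)

/-- number of occurrences -/
noncomputable def cnt (s : ℕ → A) {k : ℕ} (b : Fin k → A) (L : ℕ) : ℝ :=
  ∑ i ∈ Finset.range L, if win s k i = b then (1 : ℝ) else 0

lemma cnt_nonneg (s : ℕ → A) {k : ℕ} (b : Fin k → A) (L : ℕ) : 0 ≤ cnt s b L :=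
  Finset.sum_nonneg fun i _ => by split_ifs <;> norm_num

lemma cnt_le (s : ℕ → A) {k : ℕ} (b : Fin k → A) (L : ℕ) : cnt s b L ≤ L := by
  unfold cnt
  calc _ ≤ ∑ i ∈ Finset.range L, (1 : ℝ) :=
        Finset.sum_le_sum fun i _ => by split_ifs <;> norm_num
    _ = L := by simp

lemma cnt_total (s : ℕ → A) (k L : ℕ) : ∑ b : Fin k → A, cnt s b L = L := by
  unfold cnt
  rw [Finset.sum_comm]
  simp

lemma sum_cons (s : ℕ → A) {j : ℕ} (b : Fin j → A) (L : ℕ) :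
    ∑ a : A, cnt s (Fin.cons a b : Fin (j+1) → A) L =
      ∑ i ∈ Finset.range L, if win s j (i+1) = b then (1:ℝ) else 0 := by
  unfold cnt
  rw [Finset.sum_comm]
  refine Finset.sum_congr rfl fun i _ => ?_
  have key : ∀ a : A, (win s (j+1) i = (Fin.cons a b : Fin (j+1) → A)) ↔
      (a = s i ∧ win s j (i+1) = b) := by
    intro a
    constructor
    · intro h
      refine ⟨?_, ?_⟩
      · have := congrFun h 0
        simpa [win] using this.symm
      · funext m
        have := congrFun h m.succ
        simp only [win, Fin.cons_succ, Fin.val_succ] at this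
        simp only [win]
        rw [← this]; congr 1; ring
    · rintro ⟨rfl, rfl⟩
      funext m
      refine Fin.cases ?_ (fun m => ?_) m
      · simp [win]
      · simp only [win, Fin.cons_succ, Fin.val_succ]; congr 1; ring
  simp only [key, ite_and]
  simp

lemma sum_snoc (s : ℕ → A) {j : ℕ} (b : Fin j → A) (L : ℕ) :
    ∑ a : A, cnt s (Fin.snoc b a : Fin (j+1) → A) L =
      ∑ i ∈ Finset.range L, if win s j i = b then (1:ℝ) else 0 := by
  unfold cnt
  rw [Finset.sum_comm]
  refine Finset.sum_congr rfl fun i _ => ?_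
  have key : ∀ a : A, (win s (j+1) i = (Fin.snoc b a : Fin (j+1) → A)) ↔
      (a = s (i+j) ∧ win s j i = b) := by
    intro a
    constructor
    · intro h
      refine ⟨?_, ?_⟩
      · have := congrFun h (Fin.last j)
        simpa [win] using this.symm
      · funext m
        have := congrFun h m.castSucc
        simpa [win] using this
    · rintro ⟨rfl, rfl⟩
      funext m
      refine Fin.lastCases ?_ (fun m => ?_) m
      · simp [win]
      · simp [win]
  simp only [key, ite_and]
  simp

lemma sum_cons_sub_snoc (s : ℕ → A) {j : ℕ} (b : Fin j → A) (L : ℕ) :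
    ∑ a : A, cnt s (Fin.cons a b : Fin (j+1) → A) L
      - ∑ a : A, cnt s (Fin.snoc b a : Fin (j+1) → A) L
      = (if win s j L = b then (1:ℝ) else 0) - (if win s j 0 = b then (1:ℝ) else 0) := by
  rw [sum_cons, sum_snoc, ← Finset.sum_range_sub (fun i => if win s j i = b then (1:ℝ) else 0),
    Finset.sum_sub_distrib]

/-- concatenation -/
def cat (s : ℕ → A) (L : ℕ) (s' : ℕ → A) : ℕ → A :=
  fun i => if i < L then s i else s' (i - L)

lemma cnt_cat (s : ℕ → A) (L : ℕ) (s' : ℕ → A) {k : ℕ} (b : Fin k → A) (L' : ℕ) :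
    cnt (cat s L s') b (L + L') = cnt (cat s L s') b L + cnt s' b L' := by
  unfold cnt
  rw [Finset.sum_range_add]
  congr 1
  refine Finset.sum_congr rfl fun i _ => ?_
  have : win (cat s L s') k (L + i) = win s' k i := by
    funext m
    simp only [win, cat]
    rw [if_neg (by omega)]
    congr 1; omega
  rw [this]

lemma cnt_cat_left (s : ℕ → A) (L : ℕ) (s' : ℕ → A) {k : ℕ} (b : Fin k → A) :
    |cnt (cat s L s') b L - cnt s b L| ≤ k := by
  unfold cnt
  rw [← Finset.sum_sub_distrib]
  refine (Finset.abs_sum_le_sum_abs _ _).trans ?_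
  calc _ ≤ ∑ i ∈ Finset.range L, if L < i + k then (1:ℝ) else 0 := by
        refine Finset.sum_le_sum fun i hi => ?_
        by_cases h : L < i + k
        · rw [if_pos h]
          split_ifs <;> norm_num
        · rw [if_neg h]
          have : win (cat s L s') k i = win s k i := by
            funext m
            simp only [win, cat]
            rw [if_pos (by have := m.2; omega)]
          rw [this]; simp
    _ = (((Finset.range L).filter fun i => L < i + k).card : ℝ) := by simp
    _ ≤ k := by
        have : ((Finset.range L).filter fun i => L < i + k) ⊆ Finset.Ico (L - k) L := by
          intro i hi
          simp at hi ⊢; omega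
        have := Finset.card_le_card this
        simp at this
        have h2 : ((Finset.range L).filter fun i => L < i + k).card ≤ k := by omega
        exact_mod_cast h2

/-- bounded discrepancy realisability -/
def BddReal {k : ℕ} (p : (Fin k → A) → ℝ) : Prop :=
  ∃ K : ℝ, ∀ t : ℝ, 0 ≤ t → ∃ (s : ℕ → A) (L : ℕ), ∀ b, |cnt s b L - t * p b| ≤ K

lemma BddReal.add {k : ℕ} {p q : (Fin k → A) → ℝ} (hp : BddReal p) (hq : BddReal q) :
    BddReal (fun b => p b + q b) := by
  obtain ⟨K, hK⟩ := hp
  obtain ⟨K', hK'⟩ := hq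
  refine ⟨K + K' + k, fun t ht => ?_⟩
  obtain ⟨s, L, h⟩ := hK t ht
  obtain ⟨s', L', h'⟩ := hK' t ht
  refine ⟨cat s L s', L + L', fun b => ?_⟩
  rw [cnt_cat]
  have h1 := cnt_cat_left s L s' b
  have h2 := h b
  have h3 := h' b
  rw [abs_le] at *
  constructor <;> linarith [h1.1, h1.2, h2.1, h2.2, h3.1, h3.2]

lemma BddReal.smul {k : ℕ} {p : (Fin k → A) → ℝ} (hp : BddReal p) (r : ℝ) (hr : 0 ≤ r) :
    BddReal (fun b => r * p b) := by
  obtain ⟨K, hK⟩ := hp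
  refine ⟨K, fun t ht => ?_⟩
  obtain ⟨s, L, h⟩ := hK (t * r) (by positivity)
  exact ⟨s, L, fun b => by rw [← mul_assoc]; exact h b⟩

lemma cnt_periodic (s : ℕ → A) (l : ℕ) (hs : ∀ i, s (i + l) = s i) {k : ℕ} (b : Fin k → A)
    (m : ℕ) : cnt s b (l * m) = m * cnt s b l := by
  have hs' : ∀ m i, s (l * m + i) = s i := by
    intro m
    induction m with
    | zero => simp
    | succ m ih =>
      intro i
      rw [show l * (m+1) + i = (l * m + i) + l by ring, hs, ih]
  induction m with
  | zero => simp [cnt]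
  | succ m ih =>
    have : cnt s b (l * m + l) = cnt s b (l*m) + cnt s b l := by
      unfold cnt
      rw [Finset.sum_range_add]
      congr 1
      refine Finset.sum_congr rfl fun i _ => ?_
      have : win s k (l * m + i) = win s k i := by
        funext x
        simp only [win]
        rw [add_assoc, hs']
      rw [this]
    rw [mul_add, mul_one, this, ih]
    push_cast; ring

lemma BddReal_periodic (s : ℕ → A) (l : ℕ) (hs : ∀ i, s (i + l) = s i) {k : ℕ} :
    BddReal (fun b : Fin k → A => cnt s b l) := by
  refine ⟨l, fun t ht => ⟨s, l * ⌊t⌋₊, fun b => ?_⟩⟩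
  rw [cnt_periodic s l hs, ← sub_mul, abs_mul, abs_of_nonneg (cnt_nonneg s b l)]
  have h1 : |(⌊t⌋₊ : ℝ) - t| ≤ 1 := by
    rw [abs_le]
    constructor <;> linarith [Nat.floor_le ht, Nat.lt_floor_add_one t]
  calc _ ≤ 1 * cnt s b l := by gcongr; exact cnt_nonneg s b l
    _ ≤ l := by rw [one_mul]; exact cnt_le s b l

/-- circulation -/
def Circ {j : ℕ} (p : (Fin (j+1) → A) → ℝ) : Prop :=
  ∀ b : Fin j → A, ∑ i : A, p (Fin.cons i b) = ∑ i : A, p (Fin.snoc b i)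

lemma circ_periodic (s : ℕ → A) (l : ℕ) (hs : ∀ i, s (i + l) = s i) {j : ℕ} :
    Circ (fun b : Fin (j+1) → A => cnt s b l) := by
  intro b
  have := sum_cons_sub_snoc s b l
  have h : win s j l = win s j 0 := by
    funext m
    simp only [win]
    rw [zero_add, add_comm, hs]
  rw [h, sub_self] at this
  linarith

lemma exists_cycle {j : ℕ} (p : (Fin (j+1) → A) → ℝ) (h0 : ∀ b, 0 ≤ p b) (hc : Circ p)
    (hne : ∃ b, 0 < p b) :
    ∃ (s : ℕ → A) (l : ℕ), 0 < l ∧ (∀ i, s (i + l) = s i) ∧ ∀ i, 0 < p (win s (j+1) i) := by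
  have hnext : ∀ e : {b // 0 < p b}, ∃ a : A, 0 < p (Fin.snoc (Fin.tail e.1) a) := by
    rintro ⟨e, he⟩
    have h1 : 0 < ∑ i : A, p (Fin.cons i (Fin.tail e)) := by
      refine Finset.sum_pos' (fun i _ => h0 _) ⟨e 0, Finset.mem_univ _, ?_⟩
      rw [Fin.cons_self_tail]; exact he
    rw [hc] at h1
    by_contra! hcon
    exact absurd h1 (not_lt.2 (Finset.sum_nonpos fun i _ => hcon i))
  choose f hf using hnext
  let nx : {b // 0 < p b} → {b // 0 < p b} := fun e => ⟨Fin.snoc (Fin.tail e.1) (f e), hf e⟩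
  obtain ⟨b0, hb0⟩ := hne
  obtain ⟨m, n, hmn, heq⟩ : ∃ m n : ℕ, m < n ∧ nx^[m] ⟨b0, hb0⟩ = nx^[n] ⟨b0, hb0⟩ := by
    obtain ⟨m, n, hmn, h⟩ := Finite.exists_ne_map_eq_of_infinite
      (fun n : ℕ => nx^[n] ⟨b0, hb0⟩)
    rcases lt_or_gt_of_ne hmn with h' | h'
    · exact ⟨m, n, h', h⟩
    · exact ⟨n, m, h', h.symm⟩
  set e := nx^[m] ⟨b0, hb0⟩ with he
  have hper : nx^[n - m] e = e := by
    rw [he, ← Function.iterate_add_apply, Nat.sub_add_cancel hmn.le, ← heq]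
  have hw : ∀ (m : ℕ) (hm : m < j+1) (e : {b // 0 < p b}), e.1 ⟨m, hm⟩ = (nx^[m] e).1 0 := by
    intro m
    induction m with
    | zero => intro hm e; rfl
    | succ m ih =>
      intro hm e
      rw [Function.iterate_succ_apply, ← ih (by omega)]
      have : (⟨m, by omega⟩ : Fin (j+1)) = Fin.castSucc ⟨m, by omega⟩ := rfl
      rw [this]
      simp only [nx, Fin.snoc_castSucc]
      rfl
  refine ⟨fun i => (nx^[i] e).1 0, n - m, by omega, fun i => ?_, fun i => ?_⟩
  · show (nx^[i + (n - m)] e).1 0 = (nx^[i] e).1 0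
    rw [Function.iterate_add_apply, hper]
  · have : win (fun i => (nx^[i] e).1 0) (j+1) i = (nx^[i] e).1 := by
      funext x
      have := hw x.1 x.2 (nx^[i] e)
      simp only [win]
      rw [show i + (x : ℕ) = x + i from add_comm _ _, Function.iterate_add_apply]
      exact this.symm
    rw [this]
    exact (nx^[i] e).2

lemma real_of_circ [Nonempty A] {j : ℕ} : ∀ (n : ℕ) (p : (Fin (j+1) → A) → ℝ)
    (_ : (Finset.univ.filter fun b => 0 < p b).card = n)
    (_ : ∀ b, 0 ≤ p b) (_ : Circ p), BddReal p := by
  intro n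
  induction n using Nat.strong_induction_on with
  | _ n ih =>
  intro p hn h0 hc
  by_cases hne : ∃ b, 0 < p b
  · obtain ⟨s, l, hl, hs, hpos⟩ := exists_cycle p h0 hc hne
    have hcp : ∀ b, 0 < cnt s b l → 0 < p b := by
      intro b hb
      unfold cnt at hb
      obtain ⟨i, _, hi⟩ := Finset.exists_ne_zero_of_sum_ne_zero hb.ne'
      have : win s (j+1) i = b := by
        by_contra h; simp [h] at hi
      rw [← this]; exact hpos i
    have hne2 : (Finset.univ.filter fun b : Fin (j+1) → A => 0 < cnt s b l).Nonempty := by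
      refine ⟨win s (j+1) 0, ?_⟩
      simp only [Finset.mem_filter, Finset.mem_univ, true_and]
      unfold cnt
      exact Finset.sum_pos' (fun i _ => by split_ifs <;> norm_num)
        ⟨0, by simpa using hl, by simp⟩
    obtain ⟨b1, hb1, hmin⟩ := Finset.exists_min_image _ (fun b => p b / cnt s b l) hne2
    simp only [Finset.mem_filter, Finset.mem_univ, true_and] at hb1 hmin
    set r := p b1 / cnt s b1 l with hr
    have hr0 : 0 ≤ r := div_nonneg (h0 _) hb1.le
    have hle : ∀ b, r * cnt s b l ≤ p b := by
      intro b
      rcases (cnt_nonneg s b l).eq_or_lt with h | h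
      · rw [← h, mul_zero]; exact h0 b
      · have := hmin b h
        rwa [le_div_iff₀ h] at this
    have hrec : BddReal (fun b => p b - r * cnt s b l) := by
      refine ih _ ?_ _ rfl (fun b => sub_nonneg.2 (hle b)) ?_
      · rw [← hn]
        refine Finset.card_lt_card (Finset.ssubset_iff_of_subset ?_ |>.2 ⟨b1, ?_, ?_⟩)
        · intro b hb
          simp only [Finset.mem_filter, Finset.mem_univ, true_and] at hb ⊢
          have := mul_nonneg hr0 (cnt_nonneg s b l)
          linarith
        · simpa using hcp b1 hb1
        · simp only [Finset.mem_filter, Finset.mem_univ, true_and, not_lt]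
          rw [hr, div_mul_cancel₀ _ hb1.ne', sub_self]
      · intro b
        have h1 := hc b
        have h2 := circ_periodic s l hs (j := j) b
        simp only [Finset.sum_sub_distrib, ← Finset.mul_sum]
        rw [h1, h2]
    have := hrec.add ((BddReal_periodic s l hs (k := j+1)).smul r hr0)
    simpa using this
  · push Not at hne
    have hz : ∀ b, p b = 0 := fun b => le_antisymm (hne b) (h0 b)
    exact ⟨0, fun t _ => ⟨fun _ => Classical.arbitrary A, 0, fun b => by simp [cnt, hz]⟩⟩

lemma approx [Nonempty A] {j : ℕ} (p : (Fin (j+1) → A) → ℝ) (h0 : ∀ b, 0 ≤ p b)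
    (h1 : ∑ b, p b = 1) (hc : Circ p) (s₀ : ℕ → A) (n' n₀ : ℕ) (ε : ℝ) (hε : 0 < ε) :
    ∃ (s : ℕ → A) (L : ℕ), (∀ h < n', s h = s₀ h) ∧ n' ≤ L ∧ n₀ ≤ L ∧
      ∑ b, |cnt s b L / L - p b| < ε := by
  obtain ⟨K, hK⟩ := real_of_circ _ p rfl h0 hc
  set B : ℝ := (Fintype.card (Fin (j+1) → A) : ℝ) with hB
  have hB0 : 0 ≤ B := by positivity
  have hK0 : 0 ≤ K := by
    obtain ⟨s, L, h⟩ := hK 0 le_rfl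
    exact (abs_nonneg _).trans (h (fun _ => Classical.arbitrary A))
  set K' := K + n' with hK'
  have hK'0 : 0 ≤ K' := by positivity
  set M := B * (K' + B * K') / ε with hM
  have hM0 : 0 ≤ M := by positivity
  obtain ⟨s', L', h⟩ := hK (B * K' + n₀ + M + 1) (by positivity)
  set t := B * K' + n₀ + M + 1 with ht
  refine ⟨cat s₀ n' s', n' + L', fun h hh => by simp [cat, hh], by omega, ?_⟩
  set s := cat s₀ n' s' with hs
  set L := n' + L' with hL
  have hb : ∀ b : Fin (j+1) → A, |cnt s b L - t * p b| ≤ K' := by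
    intro b
    rw [hL, hs, cnt_cat]
    have e1 := cnt_nonneg (cat s₀ n' s') b n'
    have e2 := cnt_le (cat s₀ n' s') b n'
    have e3 := h b
    rw [abs_le] at *
    constructor <;> linarith [e3.1, e3.2]
  have hLt : |(L : ℝ) - t| ≤ B * K' := by
    have : (L : ℝ) - t = ∑ b : Fin (j+1) → A, (cnt s b L - t * p b) := by
      rw [Finset.sum_sub_distrib, cnt_total, ← Finset.mul_sum, h1, mul_one]
    rw [this]
    refine (Finset.abs_sum_le_sum_abs _ _).trans ?_
    calc _ ≤ ∑ b : Fin (j+1) → A, K' := Finset.sum_le_sum fun b _ => hb b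
      _ = B * K' := by simp [hB]
  have hLbig : n₀ + M + 1 ≤ (L : ℝ) := by
    have := (abs_le.1 hLt).1
    linarith
  have hLpos : (0:ℝ) < L := by have : (0:ℝ) ≤ n₀ := by positivity
                               linarith
  refine ⟨by have : (n₀ : ℝ) ≤ L := by linarith
             exact_mod_cast this, ?_⟩
  have hp1 : ∀ b, p b ≤ 1 := fun b => by
    rw [← h1]; exact Finset.single_le_sum (fun i _ => h0 i) (Finset.mem_univ b)
  have hterm : ∀ b, |cnt s b L / L - p b| ≤ (K' + B * K') / L := by
    intro b
    have : cnt s b L / L - p b = ((cnt s b L - t * p b) + (t - L) * p b) / L := by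
      field_simp; ring
    rw [this, abs_div, abs_of_pos hLpos]
    gcongr
    refine (abs_add_le _ _).trans (add_le_add (hb b) ?_)
    rw [abs_mul, abs_of_nonneg (h0 b), abs_sub_comm]
    calc _ ≤ B * K' * 1 := mul_le_mul hLt (hp1 b) (h0 b) (by positivity)
      _ = _ := mul_one _
  calc _ ≤ ∑ b : Fin (j+1) → A, (K' + B * K') / L := Finset.sum_le_sum fun b _ => hterm b
    _ = B * (K' + B * K') / L := by simp [hB]; ring
    _ < ε := by
      rw [div_lt_iff₀ hLpos]
      have : B * (K' + B * K') = ε * M := by rw [hM]; field_simp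
      rw [this]
      have : (0:ℝ) ≤ n₀ := by positivity
      gcongr
      linarith

end Comb

section Digits

variable {N : ℕ}

/-- integer value of the first digits -/
def V (s : ℕ → Fin N) : ℕ → ℕ
  | 0 => 0
  | n + 1 => N * V s n + s n

lemma V_inj (s s' : ℕ → Fin N) : ∀ n, V s n = V s' n → ∀ h < n, s h = s' h := by
  intro n
  induction n with
  | zero => intro _ h hh; omega
  | succ n ih =>
    intro heq h hh
    simp only [V] at heq
    have h1 := congrArg (· % N) heq
    simp only [Nat.mul_add_mod, Nat.mod_eq_of_lt (s n).2, Nat.mod_eq_of_lt (s' n).2] at h1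
    have hN : 0 < N := lt_of_le_of_lt (Nat.zero_le _) (s n).2
    have h2 : V s n = V s' n := by
      rw [h1] at heq
      exact Nat.eq_of_mul_eq_mul_left hN (Nat.add_right_cancel heq)
    rcases Nat.lt_succ_iff_lt_or_eq.1 hh with h3 | rfl
    · exact ih h2 h h3
    · exact Fin.ext h1

lemma V_congr (s s' : ℕ → Fin N) : ∀ n, (∀ h < n, s h = s' h) → V s n = V s' n := by
  intro n
  induction n with
  | zero => intro _; rfl
  | succ n ih =>
    intro h
    simp only [V]
    rw [ih (fun i hi => h i (by omega)), h n (by omega)]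

lemma V_lt (s : ℕ → Fin N) (n : ℕ) : V s n + 1 ≤ N ^ n := by
  induction n with
  | zero => simp [V]
  | succ n ih =>
    simp only [V, pow_succ]
    have := (s n).2
    nlinarith

lemma V_sum (hN : 2 ≤ N) (s : ℕ → Fin N) (n : ℕ) :
    ∑ h ∈ Finset.range n, (s h : ℝ) / (N : ℝ) ^ (h + 1) = V s n / (N : ℝ) ^ n := by
  have : (N : ℝ) ≠ 0 := by positivity
  induction n with
  | zero => simp [V]
  | succ n ih =>
    rw [Finset.sum_range_succ, ih]
    simp only [V]
    push_cast
    field_simp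
    ring

lemma V_bounds (hN : 2 ≤ N) (s : ℕ → Fin N) (x : ℝ)
    (hx : HasSum (fun h : ℕ => (s h : ℝ) / (N : ℝ) ^ (h + 1)) x) (n : ℕ) :
    V s n / (N : ℝ) ^ n ≤ x ∧ x ≤ (V s n + 1) / (N : ℝ) ^ n := by
  have hN0 : (0 : ℝ) < N := by positivity
  have ht := hx.tendsto_sum_nat
  simp only [V_sum hN] at ht
  have hm : Monotone (fun n => (V s n : ℝ) / (N : ℝ) ^ n) := by
    refine monotone_nat_of_le_succ fun n => ?_
    rw [div_le_div_iff₀ (by positivity) (by positivity), pow_succ]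
    simp only [V]
    push_cast
    have : (0:ℝ) ≤ (s n : ℕ) := by positivity
    have h2 : (0:ℝ) < N ^ n := by positivity
    nlinarith
  have ha : Antitone (fun n => ((V s n : ℝ) + 1) / (N : ℝ) ^ n) := by
    refine antitone_nat_of_succ_le fun n => ?_
    rw [div_le_div_iff₀ (by positivity) (by positivity), pow_succ]
    simp only [V]
    push_cast
    have h1 : ((s n : ℕ) : ℝ) + 1 ≤ N := by exact_mod_cast (s n).2
    have h2 : (0:ℝ) < N ^ n := by positivity
    nlinarith
  refine ⟨hm.ge_of_tendsto ht n, ?_⟩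
  refine le_of_tendsto ht ?_
  filter_upwards [eventually_ge_atTop n] with m hmn
  refine le_trans ?_ (ha hmn)
  show (V s m : ℝ) / (N : ℝ) ^ m ≤ ((V s m : ℝ) + 1) / (N : ℝ) ^ m
  gcongr
  linarith

/-- open cylinder -/
def cyl (s : ℕ → Fin N) (n : ℕ) : Set ℝ :=
  Set.Ioo ((V s n : ℝ) / (N : ℝ) ^ n) ((V s n + 1) / (N : ℝ) ^ n)

lemma digits_of_cyl (hN : 2 ≤ N) (d : ℝ → ℕ → Fin N) (hd : IsNonTerminatingDigits d)
    (x : ℝ) (hx : x ∈ Set.Ico (0:ℝ) 1) (s : ℕ → Fin N) (n : ℕ) (hxs : x ∈ cyl s n) :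
    ∀ h < n, d x h = s h := by
  have hN0 : (0 : ℝ) < N := by positivity
  obtain ⟨h1, h2⟩ := V_bounds hN (d x) x (hd x hx).1 n
  obtain ⟨h3, h4⟩ := hxs
  apply V_inj
  have h5 := lt_of_le_of_lt h1 h4
  have h6 := lt_of_lt_of_le h3 h2
  rw [div_lt_div_iff_of_pos_right (by positivity)] at h5 h6
  have h5' : V (d x) n < V s n + 1 := by exact_mod_cast h5
  have h6' : V s n < V (d x) n + 1 := by exact_mod_cast h6
  omega

lemma cyl_nonempty (hN : 2 ≤ N) (s : ℕ → Fin N) (n : ℕ) :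
    ∃ x ∈ cyl s n, x ∈ Set.Ico (0:ℝ) 1 := by
  have hN0 : (0 : ℝ) < N := by positivity
  have hl : (V s n : ℝ) / (N : ℝ) ^ n < (V s n + 1) / (N : ℝ) ^ n := by
    gcongr; linarith
  obtain ⟨x, h1, h2⟩ := exists_between hl
  refine ⟨x, ⟨h1, h2⟩, le_trans (by positivity) h1.le, lt_of_lt_of_le h2 ?_⟩
  rw [div_le_one (by positivity)]
  exact_mod_cast V_lt s n

lemma bfreq_eq (d : ℝ → ℕ → Fin N) (x : ℝ) (k n : ℕ) (b : Fin k → Fin N) :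
    bfreqVec d x k n b = cnt (d x) b n / n := by
  unfold bfreqVec bfreq cnt
  rw [Finset.card_filter]
  push_cast
  congr 1
  refine Finset.sum_congr rfl fun i _ => ?_
  have : ((List.ofFn fun m : Fin (List.ofFn b).length => d x (i + (m : ℕ))) = List.ofFn b) ↔
      win (d x) k i = b := by
    rw [List.ext_get_iff]
    simp only [List.length_ofFn, List.get_ofFn, true_and, funext_iff, win]
    constructor
    · intro h m
      simpa using h m.1 (by simp) (by simp)
    · intro h m h1 h2
      simpa using h ⟨m, by simpa using h1⟩
  simp only [this]

lemma acc_subset (d : ℝ → ℕ → Fin N) (x : ℝ) (j : ℕ) :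
    AccPts (fun n => bfreqVec d x (j + 1) n) ⊆ ShiftInvariant j := by
  rintro p ⟨hp, hacc⟩
  refine ⟨hp, fun b => ?_⟩
  set Φ := |∑ i : Fin N, p (Fin.cons i b) - ∑ i : Fin N, p (Fin.snoc b i)| with hΦ
  have key : ∀ ε : ℝ, 0 < ε → Φ ≤ (2 * N + 1) * ε := by
    intro ε hε
    obtain ⟨n0, hn0⟩ := exists_nat_gt (1 / ε)
    obtain ⟨n, hn, hdist⟩ := hacc ε hε n0
    have hn1 : 1 / ε < n := hn0.trans_le (by exact_mod_cast hn)
    have hnpos : (0:ℝ) < n := lt_trans (by positivity) hn1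
    have hpt : ∀ c, |bfreqVec d x (j+1) n c - p c| ≤ ε := fun c =>
      (Finset.single_le_sum (f := fun c => |bfreqVec d x (j+1) n c - p c|)
        (fun i _ => abs_nonneg _) (Finset.mem_univ c)).trans hdist.le
    have hs : ∀ g : Fin N → (Fin (j+1) → Fin N),
        |∑ i, bfreqVec d x (j+1) n (g i) - ∑ i, p (g i)| ≤ N * ε := by
      intro g
      rw [← Finset.sum_sub_distrib]
      refine (Finset.abs_sum_le_sum_abs _ _).trans ?_
      calc _ ≤ ∑ i : Fin N, ε := Finset.sum_le_sum fun i _ => hpt _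
        _ = N * ε := by simp
    have e1 := hs (fun i => Fin.cons i b)
    have e2 := hs (fun i => Fin.snoc b i)
    have e3 : |∑ i : Fin N, bfreqVec d x (j+1) n (Fin.cons i b)
        - ∑ i : Fin N, bfreqVec d x (j+1) n (Fin.snoc b i)| ≤ ε := by
      simp only [bfreq_eq]
      rw [← Finset.sum_div, ← Finset.sum_div, ← sub_div, sum_cons_sub_snoc, abs_div,
        abs_of_pos hnpos, div_le_iff₀ hnpos]
      rw [div_lt_iff₀ hε] at hn1
      refine le_trans ?_ (show (1:ℝ) ≤ ε * n by linarith)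
      split_ifs <;> norm_num
    rw [hΦ]
    rw [abs_le] at *
    constructor <;> linarith [e1.1, e1.2, e2.1, e2.2, e3.1, e3.2]
  have hΦ0 : Φ ≤ 0 := by
    by_contra! h
    have h2 : (0:ℝ) < 2 * N + 1 := by positivity
    have := key (Φ / (2 * (2 * N + 1))) (by positivity)
    have h3 : (2 * (N:ℝ) + 1) * (Φ / (2 * (2 * N + 1))) = Φ / 2 := by field_simp
    linarith
  exact sub_eq_zero.1 (abs_nonpos_iff.1 hΦ0)

lemma good_residual (hN : 2 ≤ N) (d : ℝ → ℕ → Fin N) (hd : IsNonTerminatingDigits d) (j : ℕ)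
    (p : (Fin (j + 1) → Fin N) → ℝ) (hp : p ∈ ShiftInvariant j) (ε : ℝ) (hε : 0 < ε) (n₀ : ℕ) :
    {y : ↥(Set.Ico (0 : ℝ) 1) | ∃ n, n₀ ≤ n ∧ dist1 (bfreqVec d (y : ℝ) (j + 1) n) p < ε}
      ∈ residual ↥(Set.Ico (0 : ℝ) 1) := by
  have : Nonempty (Fin N) := ⟨⟨0, by omega⟩⟩
  have hN0 : (0 : ℝ) < N := by positivity
  let G : Set ((ℕ → Fin N) × ℕ) :=
    {q | n₀ ≤ q.2 ∧ ∑ b : Fin (j+1) → Fin N, |cnt q.1 b q.2 / q.2 - p b| < ε}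
  let O : Set ↥(Set.Ico (0 : ℝ) 1) :=
    ⋃ q ∈ G, (Subtype.val ⁻¹' cyl q.1 (q.2 + (j+1)))
  have hO : IsOpen O :=
    isOpen_biUnion fun q _ => isOpen_Ioo.preimage continuous_subtype_val
  have hdense : Dense O := by
    rw [Metric.dense_iff]
    rintro ⟨y, hy⟩ r hr
    obtain ⟨n', hn'⟩ := exists_pow_lt_of_lt_one hr
      (show ((N:ℝ)⁻¹) < 1 from inv_lt_one_of_one_lt₀ (by exact_mod_cast hN))
    obtain ⟨s, L, hs, hnL, hn0L, hsum⟩ := approx p hp.1.1 hp.1.2 hp.2 (d y) n' n₀ ε hε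
    obtain ⟨z, hz, hz1⟩ := cyl_nonempty hN s (L + (j+1))
    refine ⟨⟨z, hz1⟩, ?_, ?_⟩
    · have hdig := digits_of_cyl hN d hd z hz1 s _ hz
      have hV : V (d z) n' = V (d y) n' :=
        V_congr _ _ _ fun h hh => by rw [hdig h (by omega), hs h hh]
      obtain ⟨a1, a2⟩ := V_bounds hN (d z) z (hd z hz1).1 n'
      obtain ⟨b1, b2⟩ := V_bounds hN (d y) y (hd y hy).1 n'
      rw [hV] at a1 a2
      rw [add_div, one_div, ← inv_pow] at a2 b2
      rw [Metric.mem_ball, Subtype.dist_eq, Real.dist_eq, abs_lt]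
      constructor <;> linarith
    · exact Set.mem_biUnion (show (s, L) ∈ G from ⟨hn0L, hsum⟩) hz
  refine mem_of_superset (residual_of_dense_open hO hdense) ?_
  intro y hy
  obtain ⟨⟨s, L⟩, ⟨hL, hsum⟩, hy2⟩ := Set.mem_iUnion₂.1 hy
  refine ⟨L, hL, ?_⟩
  have hdig := digits_of_cyl hN d hd y y.2 s _ hy2
  have hcnt : ∀ b : Fin (j+1) → Fin N, cnt (d y) b L = cnt s b L := by
    intro b
    unfold cnt
    refine Finset.sum_congr rfl fun i hi => ?_
    have : win (d y) (j+1) i = win s (j+1) i := by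
      funext m
      have h1 := m.2
      have h2 := Finset.mem_range.1 hi
      exact hdig _ (by simp only []; omega)
    rw [this]
  unfold dist1
  simp only [bfreq_eq, hcnt]
  exact hsum

lemma dist1_triangle {α : Type*} [Fintype α] (p q r : α → ℝ) :
    dist1 p r ≤ dist1 p q + dist1 q r := by
  unfold dist1
  rw [← Finset.sum_add_distrib]
  exact Finset.sum_le_sum fun i _ => abs_sub_le _ _ _

lemma dist1_le {α : Type*} [Fintype α] (p q : α → ℝ) :
    dist1 p q ≤ Fintype.card α * dist p q := by
  unfold dist1
  calc _ ≤ ∑ i : α, dist p q := Finset.sum_le_sum fun i _ => by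
        rw [← Real.dist_eq]; exact dist_le_pi_dist p q i
    _ = _ := by simp

end Digits

/-- the set of extremely non-normal numbers in base `N` — the
`x ∈ [0,1)` such that for every `k ≥ 1` the set of accumulation points of
`(Π_k(x,n))_n` equals the set `S_k` of shift-invariant probability vectors — is
residual in `[0,1)`. -/
theorem extremely_nonnormal_residual_baseN
    {N : ℕ} (hN : 2 ≤ N)
    (d : ℝ → ℕ → Fin N) (hd : IsNonTerminatingDigits d) :
    {y : ↥(Set.Ico (0 : ℝ) 1) | ∀ j : ℕ,
        AccPts (fun n => bfreqVec d (y : ℝ) (j + 1) n) = ShiftInvariant j}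
      ∈ residual ↥(Set.Ico (0 : ℝ) 1) := by
  rw [show {y : ↥(Set.Ico (0 : ℝ) 1) | ∀ j : ℕ,
        AccPts (fun n => bfreqVec d (y : ℝ) (j + 1) n) = ShiftInvariant j} =
      ⋂ j : ℕ, {y : ↥(Set.Ico (0 : ℝ) 1) |
        AccPts (fun n => bfreqVec d (y : ℝ) (j + 1) n) = ShiftInvariant j} by
    ext y; simp]
  rw [countable_iInter_mem]
  intro j
  obtain ⟨Q, hQc, hQd⟩ := TopologicalSpace.exists_countable_dense
    ↥(ShiftInvariant j : Set ((Fin (j + 1) → Fin N) → ℝ))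
  have hres : (⋂ q ∈ Q, ⋂ m : ℕ, ⋂ n₀ : ℕ, {y : ↥(Set.Ico (0 : ℝ) 1) | ∃ n, n₀ ≤ n ∧
      dist1 (bfreqVec d (y : ℝ) (j + 1) n) q.1 < 1 / ((m : ℝ) + 1)})
      ∈ residual ↥(Set.Ico (0 : ℝ) 1) := by
    rw [countable_bInter_mem hQc]
    intro q _
    rw [countable_iInter_mem]
    intro m
    rw [countable_iInter_mem]
    intro n₀
    exact good_residual hN d hd j q.1 q.2 _ (by positivity) n₀
  refine mem_of_superset hres ?_
  intro y hy
  simp only [Set.mem_iInter, Set.mem_setOf_eq] at hy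
  refine Set.Subset.antisymm (acc_subset d y j) ?_
  intro p hp
  refine ⟨hp.1, fun ε hε n₀ => ?_⟩
  set B : ℝ := (Fintype.card (Fin (j+1) → Fin N) : ℝ) with hB
  have hB0 : 0 ≤ B := by positivity
  obtain ⟨q, hqQ, hq⟩ := hQd.exists_dist_lt ⟨p, hp⟩ (show 0 < ε / (2 * (B + 1)) by positivity)
  obtain ⟨m, hm⟩ := exists_nat_one_div_lt (show 0 < ε / 2 by positivity)
  obtain ⟨n, hn, hdn⟩ := hy q hqQ m n₀
  refine ⟨n, hn, ?_⟩
  have h1 := dist1_triangle (bfreqVec d (y : ℝ) (j + 1) n) q.1 p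
  have h2 := dist1_le q.1 p
  rw [Subtype.dist_eq, dist_comm] at hq
  have h3 : B * dist q.1 p ≤ ε / 2 := by
    calc B * dist q.1 p ≤ (B + 1) * (ε / (2 * (B + 1))) := by
          gcongr
          linarith
      _ = ε / 2 := by field_simp
  calc _ ≤ _ := h1
    _ < ε / 2 + ε / 2 := by linarith
    _ = ε := by ring

end BaseN
end
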